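/- Let K be a quadratic field and let c ∈ K, with a quadratic field K and c ∈ K, and hence α and f_c²(α) Galois conjugate: if f_c admits a point α ∈ K of exact period 4, then c lies in ℚ and the nontrivial automorphism σ of K over ℚ satisfies σ(α) = f_c²(α). -/

import Mathlib

/-- The quadratic map `z ↦ z ^ 2 + c`. -/
def fc {K : Type*} [Field K] (c : K) : K → K := fun z => z ^ 2 + c

/-- `α` has exact period `m` under `fc c`. -/
def HasExactPeriod {K : Type*} [Field K] (c : K) (m : ℕ) (α : K) : Prop :=
  (fc c)^[m] α = α ∧ ∀ j : ℕ, 1 ≤ j → j < m → (fc c)^[j] α ≠ α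

/-- `α` has preperiodic type `m_n` under `fc c`: preperiod exactly `n`, eventual period `m`. -/
def HasPreperiodicType {K : Type*} [Field K] (c : K) (m n : ℕ) (α : K) : Prop :=
  HasExactPeriod c m ((fc c)^[n] α) ∧ (fc c)^[n + m - 1] α ≠ (fc c)^[n - 1] α

theorem Int.exists_sq_of_coprime_mul_pos {a b c : ℤ} (h : IsCoprime a b) (ha : 0 < a)
    (heq : a * b = c ^ 2) : ∃ d : ℤ, a = d ^ 2 := by
  obtain ⟨d, hd | hd⟩ := Int.sq_of_isCoprime h heq
  · exact ⟨d, hd⟩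
  · exact absurd hd (by nlinarith [sq_nonneg d])

theorem Int.fourth_eq_fourth_add_sq (x y z : ℤ) (h : x ^ 4 = y ^ 4 + z ^ 2) (hy : y ≠ 0) :
    z = 0 := by
  by_contra hz
  induction hn : x.natAbs using Nat.strong_induction_on generalizing x y z with
  | _ n ih =>
  subst hn
  have hx : x ≠ 0 := by
    rintro rfl
    have : 0 < y ^ 4 := by positivity
    nlinarith [sq_nonneg z]
  by_cases hxy : IsCoprime x y
  swap
  · rw [Int.isCoprime_iff_gcd_eq_one] at hxy
    obtain ⟨p, hp, hpg⟩ := Nat.exists_prime_and_dvd hxy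
    have hpx : (p : ℤ) ∣ x := (Int.natCast_dvd_natCast.2 hpg).trans (Int.gcd_dvd_left ..)
    have hpy : (p : ℤ) ∣ y := (Int.natCast_dvd_natCast.2 hpg).trans (Int.gcd_dvd_right ..)
    obtain ⟨x, rfl⟩ := hpx
    obtain ⟨y, rfl⟩ := hpy
    have hp0 : (p : ℤ) ≠ 0 := by exact_mod_cast hp.ne_zero
    have hpz : (p : ℤ) ^ 2 ∣ z := by
      rw [← Int.pow_dvd_pow_iff two_ne_zero]
      exact ⟨x ^ 4 - y ^ 4, by linear_combination -h⟩
    obtain ⟨z, rfl⟩ := hpz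
    refine ih x.natAbs ?_ x y z ?_ (right_ne_zero_of_mul hy) (right_ne_zero_of_mul hz) rfl
    · rw [Int.natAbs_mul, Int.natAbs_natCast]
      have : 0 < x.natAbs := Int.natAbs_pos.2 (right_ne_zero_of_mul hx)
      nlinarith [hp.two_le]
    · apply mul_left_cancel₀ (pow_ne_zero 4 hp0)
      linear_combination h
  have hyz : IsCoprime y z := by
    have h1 : IsCoprime (y ^ 4 + z ^ 2) y := h ▸ hxy.pow_left
    have h2 : IsCoprime (z ^ 2) y := by
      have : y ^ 4 + z ^ 2 = z ^ 2 + y * y ^ 3 := by ring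
      rw [this] at h1
      exact h1.of_add_mul_left_left
    exact (IsCoprime.pow_left_iff two_pos |>.1 h2).symm
  have hx2 : 0 < x ^ 2 := by positivity
  have hpt : PythagoreanTriple (y ^ 2) z (x ^ 2) := by
    unfold PythagoreanTriple; linear_combination -h
  have hg : Int.gcd (y ^ 2) z = 1 := Int.isCoprime_iff_gcd_eq_one.1 hyz.pow_left
  rcases Int.emod_two_eq_zero_or_one y with hy2 | hy2
  · have hz2 : z % 2 = 1 := by
      rcases Int.emod_two_eq_zero_or_one z with hz2 | hz2
      · exact absurd (hyz.isUnit_of_dvd' (Int.dvd_of_emod_eq_zero hy2)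
          (Int.dvd_of_emod_eq_zero hz2)) (by decide)
      · exact hz2
    obtain ⟨m, n, hzm, hym, hxm, hmn, hpar, hm0⟩ := hpt.symm.coprime_classification'
      (by rwa [Int.gcd_comm] at hg) hz2 hx2
    have key : ∀ m n : ℤ, y ^ 2 = 2 * m * n → x ^ 2 = m ^ 2 + n ^ 2 → IsCoprime m n → n % 2 = 0 →
        0 < m → 0 < n → False := by
      intro m n hym hxm hmn hn2 hm hn
      obtain ⟨l, rfl⟩ := Int.dvd_of_emod_eq_zero hn2
      obtain ⟨e, rfl⟩ := Int.dvd_of_emod_eq_zero hy2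
      have hml : m * l = e ^ 2 := by linarith
      have hl : 0 < l := by linarith
      have hcop : IsCoprime m l := hmn.of_mul_right_right
      have hm2 : IsCoprime m 2 := hmn.of_mul_right_left
      obtain ⟨b, rfl⟩ := Int.exists_sq_of_coprime_mul_pos hcop hm hml
      obtain ⟨a, rfl⟩ := Int.exists_sq_of_coprime_mul_pos hcop.symm hl (by rw [mul_comm]; exact hml)
      have hb2 : b ^ 2 % 2 = 1 := by
        rcases Int.emod_two_eq_zero_or_one (b ^ 2) with hb | hb
        · exact absurd (hm2.isUnit_of_dvd' (Int.dvd_of_emod_eq_zero hb) dvd_rfl) (by decide)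
        · exact hb
      have hpt2 : PythagoreanTriple (b ^ 2) (2 * a ^ 2) |x| := by
        unfold PythagoreanTriple; rw [abs_mul_abs_self]; linear_combination -hxm
      obtain ⟨k, l, hbk, hak, hxk, hkl, -, hk0⟩ := hpt2.coprime_classification'
        (Int.isCoprime_iff_gcd_eq_one.1 hmn) hb2 (abs_pos.2 hx)
      have hkl2 : k * l = a ^ 2 := by linarith
      have hk : 0 < k := by
        rcases hk0.eq_or_lt with rfl | hk
        · nlinarith
        · exact hk
      have hlp : 0 < l := by
        by_contra hl'
        nlinarith
      have hkl' := Int.isCoprime_iff_gcd_eq_one.2 hkl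
      obtain ⟨s, rfl⟩ := Int.exists_sq_of_coprime_mul_pos hkl' hk hkl2
      obtain ⟨u, rfl⟩ := Int.exists_sq_of_coprime_mul_pos hkl'.symm hlp
        (by rw [mul_comm]; exact hkl2)
      refine ih s.natAbs ?_ s u b (by linear_combination -hbk) (by rintro rfl; simp at hlp)
        (by rintro rfl; simp at hm) rfl
      zify
      rw [hxk]
      have : |s| ^ 2 = s ^ 2 := sq_abs s
      have : 0 ≤ |s| := abs_nonneg s
      nlinarith
    have hmn' := Int.isCoprime_iff_gcd_eq_one.2 hmn
    have hy0 : 0 < y ^ 2 := by positivity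
    have hm : 0 < m := by
      rcases hm0.eq_or_lt with rfl | hk
      · nlinarith
      · exact hk
    have hn : 0 < n := by
      by_contra hl'
      nlinarith
    rcases hpar with ⟨h1, h2⟩ | ⟨h1, h2⟩
    · exact key n m (by linarith) (by linarith) hmn'.symm h1 hn hm
    · exact key m n hym hxm hmn' h2 hm hn
  · obtain ⟨m, n, hym, hzm, hxm, -, -, -⟩ := hpt.coprime_classification' hg
      (by rcases Int.emod_two_eq_zero_or_one (y ^ 2) with h1 | h1
          · have := Int.prime_two.dvd_of_dvd_pow (Int.dvd_of_emod_eq_zero h1); omega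
          · exact h1) hx2
    have hn : n ≠ 0 := by rintro rfl; simp at hzm; exact hz hzm
    refine ih m.natAbs ?_ m n (x * y) ?_ hn (mul_ne_zero hx hy) rfl
    · rw [Int.natAbs_lt_iff_sq_lt]
      have : 0 < n ^ 2 := by positivity
      linarith
    · linear_combination -(x ^ 2) * hym - (m ^ 2 - n ^ 2) * hxm

theorem Int.exists_sq_of_coprime_mul_abs {a b c : ℤ} (h : IsCoprime a b) (ha : 0 < a)
    (heq : a * b = c ^ 2 ∨ a * b = -c ^ 2) : ∃ d : ℤ, a = d ^ 2 := by
  rcases heq with heq | heq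
  · exact Int.exists_sq_of_coprime_mul_pos h ha heq
  · exact Int.exists_sq_of_coprime_mul_pos h.neg_right ha (c := c) (by linear_combination -heq)

theorem curve_point_of_coprime {m n z : ℤ} (hmn : IsCoprime m n) (hn : 0 < n) (hm : m ≠ 0)
    (h : z ^ 2 = -(m * n * (m ^ 2 + n ^ 2) * (m ^ 2 - 2 * m * n - n ^ 2))) : m ^ 2 = n ^ 2 := by
  have hDn : IsCoprime (m ^ 2 + n ^ 2) n := by
    have : IsCoprime (m ^ 2 + n * n) n := (hmn.pow_left (m := 2)).add_mul_left_left n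
    rwa [← sq] at this
  have hDm : IsCoprime (m ^ 2 + n ^ 2) m := by
    have : IsCoprime (n ^ 2 + m * m) m := (hmn.symm.pow_left (m := 2)).add_mul_left_left m
    rwa [← sq, add_comm] at this
  have hEn : IsCoprime (m ^ 2 - 2 * m * n - n ^ 2) n := by
    have : IsCoprime (m ^ 2 + n * (-2 * m - n)) n := (hmn.pow_left (m := 2)).add_mul_left_left _
    rwa [show m ^ 2 + n * (-2 * m - n) = m ^ 2 - 2 * m * n - n ^ 2 by ring] at this
  have hEm : IsCoprime (m ^ 2 - 2 * m * n - n ^ 2) m := by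
    have : IsCoprime (-n ^ 2 + m * (m - 2 * n)) m :=
      (hmn.symm.pow_left (m := 2)).neg_left.add_mul_left_left _
    rwa [show -n ^ 2 + m * (m - 2 * n) = m ^ 2 - 2 * m * n - n ^ 2 by ring] at this
  obtain ⟨e, he⟩ : ∃ e, m * n = e ^ 2 ∨ m * n = -e ^ 2 :=
    Int.sq_of_isCoprime (b := -((m ^ 2 + n ^ 2) * (m ^ 2 - 2 * m * n - n ^ 2)))
      (((hDm.mul_left hEm).mul_right (hDn.mul_left hEn)).symm.neg_right) (c := z)
      (by rw [h]; ring)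
  have he0 : e ≠ 0 := by
    rintro rfl
    simp [hm, hn.ne'] at he
  obtain ⟨b, hb⟩ : ∃ b, n = b ^ 2 :=
    Int.exists_sq_of_coprime_mul_abs hmn.symm hn (c := e) (by rwa [mul_comm n m])
  obtain ⟨a, ha⟩ : ∃ a, |m| = a ^ 2 := by
    refine Int.exists_sq_of_coprime_mul_abs (b := n) (c := e) ?_ (abs_pos.2 hm) ?_
    · rcases abs_choice m with h' | h' <;> rw [h']
      exacts [hmn, hmn.neg_left]
    · rcases abs_choice m with h' | h' <;> rw [h']
      · exact he
      · rcases he with he | he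
        · right; linear_combination -he
        · left; linear_combination -he
  have hm2 : m ^ 2 = a ^ 4 := by rw [← sq_abs, ha]; ring
  have hn2 : n ^ 2 = b ^ 4 := by rw [hb]; ring
  have ha0 : a ≠ 0 := by rintro rfl; simp at hm2; exact hm hm2
  have hb0 : b ≠ 0 := by rintro rfl; simp at hb; exact hn.ne' hb
  have hD : 0 < m ^ 2 + n ^ 2 := by positivity
  obtain ⟨f, hf⟩ : ∃ f : ℤ, (m ^ 2 + n ^ 2) * (m ^ 2 - 2 * m * n - n ^ 2) = f ^ 2 ∨
      (m ^ 2 + n ^ 2) * (m ^ 2 - 2 * m * n - n ^ 2) = -f ^ 2 := by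
    have hez : e ∣ z := by
      rw [← Int.pow_dvd_pow_iff two_ne_zero, h]
      rcases he with he | he <;> rw [he]
      · exact ⟨-((m ^ 2 + n ^ 2) * (m ^ 2 - 2 * m * n - n ^ 2)), by ring⟩
      · exact ⟨((m ^ 2 + n ^ 2) * (m ^ 2 - 2 * m * n - n ^ 2)), by ring⟩
    obtain ⟨f, rfl⟩ := hez
    refine ⟨f, ?_⟩
    have he2 : e ^ 2 ≠ 0 := by positivity
    rcases he with he | he <;> rw [he] at h
    · right; apply mul_left_cancel₀ he2; linear_combination h
    · left; apply mul_left_cancel₀ he2; linear_combination -h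
  by_cases hodd : IsCoprime (m + n) 2
  · exfalso
    have hDs : IsCoprime (m ^ 2 + n ^ 2) (m + n) := by
      have h1 : IsCoprime (m + n) m := by
        have := hmn.symm.add_mul_left_left 1; rwa [mul_one, add_comm] at this
      have h2 : IsCoprime (m + n) n := by
        have := hmn.add_mul_left_left 1; rwa [mul_one] at this
      have h3 := ((hodd.mul_right (h1.mul_right h2)).neg_right.symm).add_mul_left_left (m + n)
      rwa [show -(2 * (m * n)) + (m + n) * (m + n) = m ^ 2 + n ^ 2 by ring] at h3
    have hD2 : IsCoprime (m ^ 2 + n ^ 2) 2 := by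
      have h3 := (hodd.pow_left (m := 2)).add_mul_left_left (- (m * n))
      rwa [show (m + n) ^ 2 + 2 * -(m * n) = m ^ 2 + n ^ 2 by ring] at h3
    have hDE : IsCoprime (m ^ 2 + n ^ 2) (m ^ 2 - 2 * m * n - n ^ 2) := by
      have h3 := (hD2.mul_right (hDn.mul_right hDs)).neg_right.add_mul_left_right 1
      rwa [show -(2 * (n * (m + n))) + (m ^ 2 + n ^ 2) * 1 = m ^ 2 - 2 * m * n - n ^ 2 by ring]
        at h3
    obtain ⟨g, hg⟩ := Int.exists_sq_of_coprime_mul_abs hDE hD hf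
    exact not_fermat_42 ha0 hb0 (c := g) (by rw [← hg, hm2, hn2])
  · have hs : (m + n) % 2 = 0 := by
      by_contra hs
      exact hodd (Int.isCoprime_iff_gcd_eq_one.2 (by
        rw [Int.gcd_comm]
        exact Int.isCoprime_iff_gcd_eq_one.1
          (Int.prime_two.coprime_iff_not_dvd.2 (by omega))))
    obtain ⟨s, hs⟩ := Int.dvd_of_emod_eq_zero hs
    have hD' : m ^ 2 + n ^ 2 = 2 * (2 * s ^ 2 - m * n) := by
      linear_combination (m + n + 2 * s) * hs
    obtain ⟨D, hDd⟩ : ∃ D, D = 2 * s ^ 2 - m * n := ⟨_, rfl⟩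
    rw [← hDd] at hD'
    have hDdvd : D ∣ m ^ 2 + n ^ 2 := ⟨2, by rw [hD']; ring⟩
    have hsm : IsCoprime s m := by
      have := hmn.symm.add_mul_left_left 1
      rw [mul_one, add_comm, hs] at this
      exact this.of_mul_left_right
    have hsn : IsCoprime s n := by
      have := hmn.add_mul_left_left 1
      rw [mul_one, hs] at this
      exact this.of_mul_left_right
    have hm1 : IsCoprime 2 (m * n) := by
      refine Int.prime_two.coprime_iff_not_dvd.2 fun h2 => ?_
      have h2u : ¬ IsUnit (2 : ℤ) := by decide
      rcases Int.prime_two.dvd_or_dvd h2 with h2 | h2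
      · exact h2u (hmn.isUnit_of_dvd' h2 ((Int.dvd_iff_dvd_of_dvd_add ⟨s, hs⟩).1 h2))
      · exact h2u (hmn.isUnit_of_dvd' ((Int.dvd_iff_dvd_of_dvd_add ⟨s, hs⟩).2 h2) h2)
    have hDs : IsCoprime D s := by
      have h3 := (hsm.mul_right hsn).neg_right.symm.add_mul_left_left (2 * s)
      rwa [show -(m * n) + s * (2 * s) = D by rw [hDd]; ring] at h3
    have hD2 : IsCoprime D 2 := by
      have h3 := hm1.neg_right.symm.add_mul_left_left (s ^ 2)
      rwa [show -(m * n) + 2 * s ^ 2 = D by rw [hDd]; ring] at h3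
    have hDE : IsCoprime D (D - 2 * (n * s)) := by
      have h3 := (hD2.mul_right
        ((hDn.of_isCoprime_of_dvd_left hDdvd).mul_right hDs)).neg_right.add_mul_left_right 1
      rwa [show -(2 * (n * s)) + D * 1 = D - 2 * (n * s) by ring] at h3
    have hE : m ^ 2 - 2 * m * n - n ^ 2 = 2 * (D - 2 * (n * s)) := by
      linear_combination hD' - 2 * n * hs
    rw [hD', hE] at hf
    obtain ⟨f, rfl⟩ : 2 ∣ f := by
      apply Int.prime_two.dvd_of_dvd_pow (n := 2)
      rcases hf with hf | hf
      · exact ⟨2 * (D * (D - 2 * (n * s))), by rw [← hf]; ring⟩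
      · exact ⟨-(2 * (D * (D - 2 * (n * s)))), by linear_combination hf⟩
    obtain ⟨g, hg⟩ := Int.exists_sq_of_coprime_mul_abs hDE (by linarith) (c := f)
      (by rcases hf with hf | hf
          · left; linarith
          · right; linarith)
    have h4 : g ^ 4 = (a * b) ^ 4 + (D - n ^ 2) ^ 2 := by
      have : g ^ 4 = D ^ 2 := by rw [hg]; ring
      rw [this, mul_pow, ← hm2, ← hn2]
      linear_combination -n ^ 2 * hD'
    have := Int.fourth_eq_fourth_add_sq g (a * b) (D - n ^ 2) h4 (mul_ne_zero ha0 hb0)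
    linarith

/-- The affine rational points of the genus two curve parametrizing cycles of length four. -/
theorem curve_rational_points (x y : ℚ) (h : y ^ 2 = -x * (x ^ 2 + 1) * (x ^ 2 - 2 * x - 1)) :
    x = 0 ∨ x = 1 ∨ x = -1 := by
  by_cases hx : x = 0
  · exact Or.inl hx
  right
  have hd : (0 : ℤ) < x.den := by exact_mod_cast x.pos
  have hd0 : (x.den : ℚ) ≠ 0 := by exact_mod_cast x.den_nz
  have hxd : (x.num : ℚ) = x * x.den := (Rat.mul_den_eq_num x).symm
  have hsq : IsSquare (-(x.num * x.den * (x.num ^ 2 + x.den ^ 2) *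
      (x.num ^ 2 - 2 * x.num * x.den - (x.den : ℤ) ^ 2))) := by
    rw [← Rat.isSquare_intCast_iff]
    refine ⟨y * x.den ^ 3, ?_⟩
    push_cast
    rw [hxd]
    linear_combination -(x.den : ℚ) ^ 6 * h
  obtain ⟨z, hz⟩ := hsq
  have hc : IsCoprime x.num (x.den : ℤ) :=
    Int.isCoprime_iff_gcd_eq_one.2 (by simpa [Int.gcd] using x.reduced)
  have := curve_point_of_coprime hc hd (Rat.num_ne_zero.2 hx) (z := z) (by rw [hz]; ring)
  have h2 : (x.num : ℚ) ^ 2 = (x.den : ℚ) ^ 2 := by exact_mod_cast this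
  rw [hxd, mul_pow] at h2
  have : x ^ 2 = 1 := mul_right_cancel₀ (pow_ne_zero 2 hd0) (by rw [h2, one_mul])
  simpa using this

/-- The binary quadratic form `c ^ 2 - 2 * a * c + 2 * a ^ 2` entering the equation of the Kummer
surface of the Jacobian of `y ^ 2 = -x * (x ^ 2 + 1) * (x ^ 2 - 2 * x - 1)`. -/
def qf {R : Type*} [CommRing R] (a c : R) : R := c ^ 2 - 2 * a * c + 2 * a ^ 2

/-- A solution of the two quartic equations produces a rational point `(a : b : c : d)` of the
Kummer surface `(qf b d - qf a c) ^ 2 = 16 * (a * b * c * d)` whose double is the given point,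
together with the bilinear relations expressing this. -/
theorem exists_kummer_half (p q r t w : ℚ) (hp : p ≠ 0) (hq : q ≠ 0) (hw : w ≠ 0)
    (hG : p ^ 2 - q ^ 2 ≠ 0)
    (h1 : qf (2 * q ^ 2) (t ^ 2) - qf (2 * p ^ 2) (r ^ 2) = 8 * p * q * r * t)
    (h2 : qf (2 * q ^ 2 - 2 * p ^ 2) (t ^ 2 - r ^ 2) = w ^ 2) :
    ∃ a b c d k s : ℚ, a ≠ 0 ∧ b ≠ 0 ∧ c ≠ 0 ∧ d ≠ 0 ∧
      a * d + b * c = k * (p ^ 2 + q ^ 2) ∧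
      qf b d - qf a c = 2 * k * (p ^ 2 - q ^ 2) ∧
      2 * (c * d + 2 * a * b) = k * (r ^ 2 + t ^ 2) ∧
      2 * (a * c - b * d) = k * (r ^ 2 - t ^ 2 - 2 * p ^ 2 + 2 * q ^ 2) ∧
      4 * (a * b * c * d) = k ^ 2 * (p ^ 2 - q ^ 2) ^ 2 ∧
      2 * a * c * qf (b - a) (d - c) = s ^ 2 := by
  obtain ⟨G, hGd⟩ : ∃ G, G = p ^ 2 - q ^ 2 := ⟨_, rfl⟩
  obtain ⟨H, hHd⟩ : ∃ H, H = t ^ 2 - r ^ 2 := ⟨_, rfl⟩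
  obtain ⟨M, hMd⟩ : ∃ M, M = p ^ 2 + q ^ 2 := ⟨_, rfl⟩
  obtain ⟨N, hNd⟩ : ∃ N, N = r ^ 2 + t ^ 2 := ⟨_, rfl⟩
  obtain ⟨A, hAd⟩ : ∃ A, A = H + 2 * G := ⟨_, rfl⟩
  have hG0 : G ≠ 0 := hGd ▸ hG
  have hw2 : w ^ 2 = A ^ 2 + 4 * G ^ 2 := by
    rw [← h2, hAd, hHd, hGd, qf]; ring
  have e1 : H * (N - 2 * M) + 2 * G * (N - 4 * M) = 8 * p * q * r * t := by
    rw [← h1, hHd, hNd, hMd, hGd, qf, qf]; ring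
  have epq : 4 * p ^ 2 * q ^ 2 = M ^ 2 - G ^ 2 := by rw [hMd, hGd]; ring
  have ert : 4 * r ^ 2 * t ^ 2 = N ^ 2 - H ^ 2 := by rw [hNd, hHd]; ring
  have e2 : (H * (N - 2 * M) + 2 * G * (N - 4 * M)) ^ 2 =
      4 * (M ^ 2 - G ^ 2) * (N ^ 2 - H ^ 2) := by
    rw [e1, ← epq, ← ert]; ring
  obtain ⟨v, hvd⟩ : ∃ v, v = (2 * G ^ 2 * (A + 2 * G) - N * A * M) / (2 * p * q * w) := ⟨_, rfl⟩
  have hv : v * (2 * p * q * w) = 2 * G ^ 2 * (A + 2 * G) - N * A * M := by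
    rw [hvd]; field_simp
  have hv2 : v ^ 2 = N ^ 2 - 8 * G ^ 2 := by
    have h0 : (2 * p * q * w) ^ 2 ≠ 0 := by positivity
    apply mul_right_cancel₀ h0
    have : (v * (2 * p * q * w)) ^ 2 = (2 * G ^ 2 * (A + 2 * G) - N * A * M) ^ 2 := by rw [hv]
    have h3 : (2 * G ^ 2 * (A + 2 * G) - N * A * M) ^ 2 =
        (N ^ 2 - 8 * G ^ 2) * ((M ^ 2 - G ^ 2) * (A ^ 2 + 4 * G ^ 2)) := by
      rw [hAd]
      linear_combination (G^2) * e2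
    calc _ = (v * (2 * p * q * w)) ^ 2 := by ring
      _ = _ := by rw [this, h3, ← epq, ← hw2]; ring
  have hS : w * (w - A) * (2 * N * M + 2 * G * H - (N - 2 * M) * w) =
      2 * ((A - w) * (p * t + q * r) + 2 * G * (p * t - q * r)) ^ 2 := by
    have e3 : 2 * (N * M + G * H) = 4 * (p ^ 2 * t ^ 2 + q ^ 2 * r ^ 2) := by
      rw [hNd, hMd, hGd, hHd]; ring
    have e4 : H * M + G * N = 2 * (p ^ 2 * t ^ 2 - q ^ 2 * r ^ 2) := by
      rw [hNd, hMd, hGd, hHd]; ring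
    have e5 : A * (N - 2 * M) = 8 * p * q * r * t + 4 * G * M := by
      rw [hAd, ← e1]; ring
    linear_combination (w * (w - A)) * e3
      + (4 * A * G - 4 * w * G) * e4 + (w ^ 2 - w * A - 4 * G ^ 2) * e5
      + (4 * p * q * r * t + 4 * G * M + 2 * (p ^ 2 * t ^ 2 + q ^ 2 * r ^ 2)
        - w * (N - 2 * M)) * hw2
      + (4 * A * G * M - 4 * w * G * M) * hAd
  have hpq : (p - q) * (p + q) = G := by rw [hGd]; ring
  have hpmq : p - q ≠ 0 := fun h => hG0 (by rw [← hpq, h, zero_mul])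
  have hppq : p + q ≠ 0 := fun h => hG0 (by rw [← hpq, h, mul_zero])
  have hNv : (N - v) * (N + v) = 8 * G ^ 2 := by linear_combination -hv2
  have hwA : (w - A) * (w + A) = 4 * G ^ 2 := by linear_combination hw2
  have hNv0 : N - v ≠ 0 := fun h => by
    rw [h, zero_mul] at hNv; exact absurd hNv.symm (by positivity)
  have hwA0 : w - A ≠ 0 := fun h => by
    rw [h, zero_mul] at hwA; exact absurd hwA.symm (by positivity)
  obtain ⟨x, hx⟩ : ∃ x, x = (N - v) / 8 := ⟨_, rfl⟩
  obtain ⟨y, hy⟩ : ∃ y, y = (w - A) / 4 := ⟨_, rfl⟩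
  obtain ⟨z, hz⟩ : ∃ z, z = (p - q) ^ 2 / 2 := ⟨_, rfl⟩
  obtain ⟨x', hx'⟩ : ∃ x', x' = (N + v) / 4 := ⟨_, rfl⟩
  obtain ⟨y', hy'⟩ : ∃ y', y' = (w + A) / 4 := ⟨_, rfl⟩
  obtain ⟨z', hz'⟩ : ∃ z', z' = (p + q) ^ 2 / 2 := ⟨_, rfl⟩
  have hx0 : x ≠ 0 := by rw [hx]; positivity
  have hy0 : y ≠ 0 := by rw [hy]; positivity
  have hz0 : z ≠ 0 := by rw [hz]; positivity
  obtain ⟨d, hd⟩ : ∃ d, d = G ^ 2 / 4 := ⟨_, rfl⟩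
  have hd0 : d ≠ 0 := by rw [hd]; positivity
  have hxd : x * x' = d := by rw [hx, hx', hd]; linear_combination hNv / 32
  have hyd : y * y' = d := by rw [hy, hy', hd]; linear_combination hwA / 16
  have hzd : z * z' = d := by rw [hz, hz', hd, ← hpq]; ring
  have hbd : x * z * d = x * y * z * y' := by rw [← hyd]; ring
  have hd2 : d * d ^ 2 = x * y * z * (x' * y' * z') := by
    calc d * d ^ 2 = (x * x') * (y * y') * (z * z') := by rw [hxd, hyd, hzd]; ring
      _ = _ := by ring
  have hb2 : d * (x * z) ^ 2 = x * y * z * (x * z * y') := by rw [← hyd]; ring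
  have hc2 : d * (y * z) ^ 2 = x * y * z * (y * z * x') := by rw [← hxd]; ring
  have ha2 : d * (x * y) ^ 2 = x * y * z * (x * y * z') := by rw [← hzd]; ring
  have hdiff : z' * (x' * y' - 2 * x * y) - z * (y * x' - 2 * x * y') = 2 * d * (y' - y + G) := by
    rw [hx, hy, hz, hx', hy', hz', hd]
    linear_combination hv / 8 - N * A / 8 * hMd
  have hsum : w * (z' * (x' * y' + 2 * x * y) + z * (y * x' + 2 * x * y')) =
      d * (2 * N * M + A * (A + 2 * G)) := by
    rw [hx, hy, hz, hx', hy', hz', hd]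
    linear_combination A * hv / 8 - N * w ^ 2 / 8 * hMd + N * M / 8 * hw2
  refine ⟨x * y, x * z, y * z, d, x * y * z,
    x * y * z * ((A - w) * (p * t + q * r) + 2 * G * (p * t - q * r)) / w,
    by positivity, by positivity, by positivity, hd0, ?_, ?_, ?_, ?_, ?_, ?_⟩
  · rw [← hzd, ← hMd]
    have : z + z' = M := by rw [hz, hz', hMd]; ring
    linear_combination x * y * z * this
  · rw [← hGd]
    apply mul_left_cancel₀ hd0
    simp only [qf]
    linear_combination hd2 + 2 * hb2 - hc2 - 2 * ha2 - 2 * d * hbd + x * y * z * hdiff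
  · rw [← hNd]
    have : x' + 2 * x = N / 2 := by rw [hx, hx']; ring
    linear_combination 2 * x * y * z * this - 2 * y * z * hxd
  · have : y - y' = -A / 2 := by rw [hy, hy']; ring
    have : r ^ 2 - t ^ 2 - 2 * p ^ 2 + 2 * q ^ 2 = - A := by rw [hAd, hHd, hGd]; ring
    rw [this]
    linear_combination 2 * x * y * z * ‹y - y' = -A / 2› - 2 * hbd
  · rw [← hGd]
    linear_combination 4 * (x * y * z) ^ 2 * hd
  · have hQ : w * qf (x * z - x * y) (d - y * z) =
        x * y * z * (2 * N * M + 2 * G * H - (N - 2 * M) * w) := by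
      apply mul_left_cancel₀ hd0
      simp only [qf]
      have hx1 : x' + 2 * x = N / 2 := by rw [hx, hx']; ring
      have hy1 : y + y' = w / 2 := by rw [hy, hy']; ring
      have hz1 : z + z' = M := by rw [hz, hz', hMd]; ring
      linear_combination w * (hd2 + hc2 + 2 * hb2 + 2 * ha2) + x * y * z * hsum
        - 2 * w * d * hbd + 2 * w * d * y * z * hxd - 2 * w * d * x * y * hzd
        - 2 * w * d * x * y * z * (hx1 + hy1 - hz1) - x * y * z * d * hw2
        + 2 * G * d * x * y * z * hAd
    have hw2' : w ^ 2 ≠ 0 := by positivity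
    rw [div_pow, eq_div_iff hw2']
    linear_combination 2 * (x * y) * (y * z) * w * hQ
      + 2 * x ^ 2 * y ^ 2 * z ^ 2 * w * (2 * N * M + 2 * G * H - (N - 2 * M) * w) * hy
      + x ^ 2 * y ^ 2 * z ^ 2 / 2 * hS

theorem padicValInt_sq {p : ℕ} [Fact p.Prime] (a : ℤ) :
    padicValInt p (a ^ 2) = 2 * padicValInt p a := by
  rcases eq_or_ne a 0 with rfl | ha
  · simp
  · rw [sq, padicValInt.mul ha ha]; ring

theorem padicValInt_pos_iff {p : ℕ} [Fact p.Prime] {a : ℤ} (ha : a ≠ 0) :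
    0 < padicValInt p a ↔ (p : ℤ) ∣ a := by
  have := padicValInt_dvd_iff (p := p) 1 a
  rw [pow_one] at this
  rw [this]
  simp [ha, Nat.succ_le_iff]

theorem padicValInt_two_of_odd {p : ℕ} [hp : Fact p.Prime] (h2 : p ≠ 2) : padicValInt p 2 = 0 := by
  apply padicValInt.eq_zero_of_not_dvd
  intro h
  have : p ∣ 2 := by exact_mod_cast h
  exact h2 ((Nat.prime_dvd_prime_iff_eq hp.out Nat.prime_two).1 this)

theorem exists_sq_or_two_mul_sq {n : ℤ} (hn : 0 < n)
    (h : ∀ p : ℕ, ∀ _ : Fact p.Prime, p ≠ 2 → Even (padicValInt p n)) :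
    ∃ m : ℤ, n = m ^ 2 ∨ n = 2 * m ^ 2 := by
  obtain ⟨k, rfl⟩ := Int.eq_ofNat_of_zero_le hn.le
  obtain ⟨s, b, hs, hb, rfl, hsf⟩ := Nat.sq_mul_squarefree_of_pos (by exact_mod_cast hn : 0 < k)
  have hs2 : s ∣ 2 := by
    by_cases h1 : s ∣ 1
    · exact h1.trans (one_dvd 2)
    have : ∀ p : ℕ, p.Prime → p ∣ s → p = 2 := by
      intro p hp hps
      by_contra hp2
      have := Fact.mk hp
      have hv := h p ⟨hp⟩ hp2
      have h1 : padicValInt p (s : ℤ) = 1 := by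
        have hle : ¬ 2 ≤ padicValInt p (s : ℤ) := fun hle => by
          have := (padicValInt_dvd_iff (p := p) 2 (s : ℤ)).2 (Or.inr hle)
          have : p * p ∣ s := by rw [← sq]; exact_mod_cast this
          exact hp.not_isUnit (hsf p this)
        have hge := (padicValInt_pos_iff (p := p) (a := (s : ℤ)) (by exact_mod_cast hs.ne')).2
          (by exact_mod_cast hps)
        omega
      push_cast at hv
      rw [padicValInt.mul (by positivity) (by positivity), padicValInt_sq, h1] at hv
      exact absurd hv (by simp [parity_simps])
    obtain ⟨p, hp, hps⟩ := Nat.exists_prime_and_dvd (mt Nat.dvd_one.2 h1)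
    obtain rfl := this p hp hps
    obtain ⟨u, rfl⟩ := hps
    have hu : u = 1 := by
      by_contra hu
      obtain ⟨p, hp, hpu⟩ := Nat.exists_prime_and_dvd hu
      obtain rfl := this p hp (hpu.mul_left 2)
      exact hp.not_isUnit (hsf 2 (mul_dvd_mul_left 2 hpu))
    simp [hu]
  rcases (Nat.dvd_prime Nat.prime_two).1 hs2 with rfl | rfl
  · exact ⟨b, Or.inl (by push_cast; ring)⟩
  · exact ⟨b, Or.inr (by push_cast; ring)⟩

theorem exists_sq_of_even_padicValInt {n : ℤ} (hn : 0 < n)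
    (h : ∀ p : ℕ, ∀ _ : Fact p.Prime, Even (padicValInt p n)) : ∃ m : ℤ, n = m ^ 2 := by
  obtain ⟨m, hm | hm⟩ := exists_sq_or_two_mul_sq hn fun p hp _ => h p hp
  · exact ⟨m, hm⟩
  · exfalso
    have hm0 : m ≠ 0 := by rintro rfl; simp at hm; exact hn.ne' hm
    have h2 := h 2 ⟨Nat.prime_two⟩
    have : Fact (Nat.Prime 2) := ⟨Nat.prime_two⟩
    have h3 : padicValInt 2 2 = 1 := padicValInt_self
    rw [hm, padicValInt.mul two_ne_zero (pow_ne_zero 2 hm0), padicValInt_sq, h3] at h2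
    exact absurd h2 (by simp [parity_simps])

/-- A point of the Kummer surface with positive coprime integral coordinates that lifts to the
Jacobian. -/
structure PrimPoint (a b c d : ℤ) : Prop where
  ha : 0 < a
  hb : 0 < b
  hc : 0 < c
  hd : 0 < d
  prim : ∀ p : ℕ, p.Prime → (p : ℤ) ∣ a → (p : ℤ) ∣ b → (p : ℤ) ∣ c → (p : ℤ) ∣ d → False
  kum : (qf b d - qf a c) ^ 2 = 16 * (a * b * c * d)
  lift_left : ∃ s, 2 * a * c * qf (b - a) (d - c) = s ^ 2
  lift_right : ∃ s, 2 * b * d * qf (b - a) (d - c) = s ^ 2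

namespace PrimPoint

variable {a b c d : ℤ}

theorem symm (h : PrimPoint a b c d) : PrimPoint b a d c where
  ha := h.hb
  hb := h.ha
  hc := h.hd
  hd := h.hc
  prim p hp h1 h2 h3 h4 := h.prim p hp h2 h1 h4 h3
  kum := by linear_combination h.kum
  lift_left := by
    obtain ⟨s, hs⟩ := h.lift_right
    exact ⟨s, by rw [← hs]; simp only [qf]; ring⟩
  lift_right := by
    obtain ⟨s, hs⟩ := h.lift_left
    exact ⟨s, by rw [← hs]; simp only [qf]; ring⟩

theorem qf_sub_pos (h : PrimPoint a b c d) : 0 < qf (b - a) (d - c) := by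
  have h0 : 0 ≤ qf (b - a) (d - c) := by
    simp only [qf]; nlinarith [sq_nonneg (b - a), sq_nonneg (d - c - (b - a))]
  refine h0.lt_of_ne fun h1 => ?_
  have h2 : (b - a) ^ 2 = 0 := by
    simp only [qf] at h1; nlinarith [sq_nonneg (b - a), sq_nonneg (d - c - (b - a))]
  have h3 : (d - c - (b - a)) ^ 2 = 0 := by
    simp only [qf] at h1; nlinarith [sq_nonneg (b - a), sq_nonneg (d - c - (b - a))]
  have h4 : b = a := by linarith [pow_eq_zero_iff two_ne_zero |>.1 h2]
  have h5 : d = c := by linarith [pow_eq_zero_iff two_ne_zero |>.1 h3]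
  have := h.kum
  subst h4 h5
  have := h.hb; have := h.hd
  have : 0 < 16 * (b * b * d * d) := by positivity
  nlinarith [h.kum]

theorem qf_add_mul_qf_sub (h : (qf b d - qf a c) ^ 2 = 16 * (a * b * c * d)) :
    qf (b + a) (d + c) * qf (b - a) (d - c) = (2 * (a * d + b * c)) ^ 2 := by
  simp only [qf] at *
  linear_combination h

theorem qf_add_pos (h : PrimPoint a b c d) : 0 < qf (b + a) (d + c) := by
  have h1 := qf_add_mul_qf_sub h.kum
  have h2 := h.qf_sub_pos
  have := h.ha; have := h.hb; have := h.hc; have := h.hd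
  have h3 : 0 < (2 * (a * d + b * c)) ^ 2 := by positivity
  rw [← h1] at h3
  exact pos_of_mul_pos_left h3 h2.le

variable {p : ℕ} [hp : Fact p.Prime]

local notation "v" => padicValInt p

theorem even_val_prod (h : PrimPoint a b c d) : Even (v a + v b + v c + v d) := by
  have := h.ha; have := h.hb; have := h.hc; have := h.hd
  have h4 : (4 : ℤ) ∣ qf b d - qf a c := by
    rw [← Int.pow_dvd_pow_iff two_ne_zero]
    exact ⟨a * b * c * d, by rw [h.kum]; ring⟩
  obtain ⟨e, he⟩ := h4
  have he2 : a * b * c * d = e ^ 2 := by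
    have := h.kum; rw [he] at this; linarith
  have := congrArg v he2
  rw [padicValInt.mul (by positivity) (by positivity), padicValInt.mul (by positivity)
    (by positivity), padicValInt.mul (by positivity) (by positivity), padicValInt_sq] at this
  exact ⟨_, by rw [this]; ring⟩

theorem even_val_lift_left (h : PrimPoint a b c d) (hp2 : p ≠ 2) :
    Even (v a + v c + v (qf (b - a) (d - c))) := by
  have := h.ha; have := h.hc; have := h.qf_sub_pos
  obtain ⟨s, hs⟩ := h.lift_left
  have := congrArg v hs
  rw [padicValInt.mul (by positivity) (by positivity), padicValInt.mul (by positivity)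
    (by positivity), padicValInt.mul (by positivity) (by positivity), padicValInt_sq,
    padicValInt_two_of_odd hp2, zero_add] at this
  exact ⟨_, by rw [this]; ring⟩

theorem val_qf_add (h : PrimPoint a b c d) (hp2 : p ≠ 2) :
    v (qf (b + a) (d + c)) + v (qf (b - a) (d - c)) = 2 * v (a * d + b * c) := by
  have := h.ha; have := h.hb; have := h.hc; have := h.hd
  have h1 := h.qf_sub_pos; have h2 := h.qf_add_pos
  have := congrArg v (qf_add_mul_qf_sub h.kum)
  rwa [padicValInt.mul h2.ne' h1.ne', padicValInt_sq,
    padicValInt.mul (by positivity) (by positivity), padicValInt_two_of_odd hp2, zero_add] at this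

theorem not_dvd_two (hp2 : p ≠ 2) : ¬ (p : ℤ) ∣ 2 := by
  intro h
  have : p ∣ 2 := by exact_mod_cast h
  exact hp2 ((Nat.prime_dvd_prime_iff_eq hp.out Nat.prime_two).1 this)

theorem prime_int : Prime (p : ℤ) := Nat.prime_iff_prime_int.1 hp.out

theorem dvd_kum (h : PrimPoint a b c d) (habcd : (p : ℤ) ∣ a * b * c * d) :
    (p : ℤ) ∣ qf b d - qf a c :=
  prime_int.dvd_of_dvd_pow (n := 2) (h.kum ▸ habcd.mul_left 16)

theorem dvd_sq_sub_sq (h : PrimPoint a b c d) (ha : (p : ℤ) ∣ a) (hb : (p : ℤ) ∣ b) :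
    (p : ℤ) ∣ d ^ 2 - c ^ 2 := by
  have := h.dvd_kum (((ha.mul_right b).mul_right c).mul_right d)
  obtain ⟨x, rfl⟩ := ha
  obtain ⟨y, rfl⟩ := hb
  obtain ⟨z, hz⟩ := this
  simp only [qf] at hz
  exact ⟨z + 2 * y * d - 2 * p * y ^ 2 - 2 * x * c + 2 * p * x ^ 2, by linear_combination hz⟩

theorem dvd_sq_sub_sq' (h : PrimPoint a b c d) (hp2 : p ≠ 2) (hc : (p : ℤ) ∣ c)
    (hd : (p : ℤ) ∣ d) : (p : ℤ) ∣ b ^ 2 - a ^ 2 := by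
  have := h.dvd_kum (hd.mul_left (a * b * c))
  obtain ⟨x, rfl⟩ := hc
  obtain ⟨y, rfl⟩ := hd
  obtain ⟨z, hz⟩ := this
  simp only [qf] at hz
  refine (prime_int.dvd_or_dvd (a := 2) ?_).resolve_left (not_dvd_two hp2)
  exact ⟨z + 2 * y * b - p * y ^ 2 - 2 * x * a + p * x ^ 2, by linear_combination hz⟩

theorem not_dvd_of_dvd_left (h : PrimPoint a b c d) (ha : (p : ℤ) ∣ a) (hb : (p : ℤ) ∣ b) :
    ¬ (p : ℤ) ∣ c ∧ ¬ (p : ℤ) ∣ d := by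
  have h1 := h.dvd_sq_sub_sq ha hb
  constructor
  · intro hc
    exact h.prim p hp.out ha hb hc (prime_int.dvd_of_dvd_pow (n := 2)
      ((dvd_sub_left (dvd_pow hc two_ne_zero)).1 h1))
  · intro hd
    exact h.prim p hp.out ha hb (prime_int.dvd_of_dvd_pow (n := 2)
      ((dvd_sub_right (dvd_pow hd two_ne_zero)).1 h1)) hd

theorem not_dvd_of_dvd_right (h : PrimPoint a b c d) (hp2 : p ≠ 2) (hc : (p : ℤ) ∣ c)
    (hd : (p : ℤ) ∣ d) : ¬ (p : ℤ) ∣ a ∧ ¬ (p : ℤ) ∣ b := by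
  have h1 := h.dvd_sq_sub_sq' hp2 hc hd
  constructor
  · intro ha
    exact h.prim p hp.out ha (prime_int.dvd_of_dvd_pow (n := 2)
      ((dvd_sub_left (dvd_pow ha two_ne_zero)).1 h1)) hc hd
  · intro hb
    exact h.prim p hp.out (prime_int.dvd_of_dvd_pow (n := 2)
      ((dvd_sub_right (dvd_pow hb two_ne_zero)).1 h1)) hb hc hd

theorem even_of_dvd_ad (h : PrimPoint a b c d) (hp2 : p ≠ 2) (ha : (p : ℤ) ∣ a)
    (hd : (p : ℤ) ∣ d) (hb : ¬ (p : ℤ) ∣ b) (hc : ¬ (p : ℤ) ∣ c) : Even (v a + v b) := by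
  have h1 := h.dvd_kum (hd.mul_left (a * b * c))
  have hq : ¬ (p : ℤ) ∣ qf (b - a) (d - c) := by
    obtain ⟨x, rfl⟩ := ha
    obtain ⟨y, rfl⟩ := hd
    obtain ⟨z, hz⟩ := h1
    rintro ⟨u, hu⟩
    simp only [qf] at hz hu
    have hbc : (p : ℤ) ∣ 2 * (b * (2 * b + c)) :=
      ⟨u + z - 2 * p * y ^ 2 + 2 * y * c + 4 * y * b
        + 4 * b * x - 2 * p * x * y, by linear_combination hu + hz⟩
    have hbc := (prime_int.dvd_or_dvd hbc).resolve_left (not_dvd_two hp2)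
    have hbc := (prime_int.dvd_or_dvd hbc).resolve_left hb
    obtain ⟨g, hg⟩ := hbc
    have : (p : ℤ) ∣ 2 * b ^ 2 := 
      ⟨-z + p * y ^ 2 - 2 * b * y - p * g ^ 2 + 4 * g * b + 2 * x * c - 2 * p * x ^ 2, by
        linear_combination -hz - (c + p * g - 2 * b) * hg⟩
    have := (prime_int.dvd_or_dvd this).resolve_left (not_dvd_two hp2)
    exact hb (prime_int.dvd_of_dvd_pow this)
  have h2 := h.even_val_lift_left hp2
  rw [padicValInt.eq_zero_of_not_dvd hq, padicValInt.eq_zero_of_not_dvd hc] at h2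
  rw [padicValInt.eq_zero_of_not_dvd hb]
  exact h2

theorem not_odd_of_dvd_ac (h : PrimPoint a b c d) (hp2 : p ≠ 2) (hb : ¬ (p : ℤ) ∣ b)
    (hd : ¬ (p : ℤ) ∣ d) (hao : Odd (v a)) (hco : Odd (v c)) : False := by
  have ha0 := h.ha; have hb0 := h.hb; have hc0 := h.hc; have hd0 := h.hd
  have hm := h.qf_sub_pos; have hpl := h.qf_add_pos
  have hvb := padicValInt.eq_zero_of_not_dvd hb
  have hvd := padicValInt.eq_zero_of_not_dvd hd
  have hevm := h.symm.even_val_lift_left hp2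
  have hneg : qf (a - b) (c - d) = qf (b - a) (d - c) := by simp only [qf]; ring
  rw [hneg, hvb, hvd] at hevm
  have hsum := h.val_qf_add hp2
  obtain ⟨r, hr⟩ : ∃ r, r = min (v a) (v c) := ⟨_, rfl⟩
  have hro : Odd r := by
    rcases min_choice (v a) (v c) with h' | h' <;> rw [hr, h'] <;> assumption
  have hra : (p : ℤ) ^ r ∣ a := (padicValInt_dvd_iff r a).2 (Or.inr (hr ▸ min_le_left _ _))
  have hrc : (p : ℤ) ^ r ∣ c := (padicValInt_dvd_iff r c).2 (Or.inr (hr ▸ min_le_right _ _))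
  have hr2 : ((p : ℤ) ^ r) ^ 2 ∣ qf a c := by
    obtain ⟨x, hx⟩ := hra
    obtain ⟨y, hy⟩ := hrc
    exact ⟨qf x y, by rw [hx, hy]; simp only [qf]; ring⟩
  have hX : (qf b d - qf a c) ^ 2 ≠ 0 := by rw [h.kum]; positivity
  have hX0 : qf b d - qf a c ≠ 0 := fun h0 => hX (by rw [h0]; ring)
  have hvX : 2 * v (qf b d - qf a c) = v a + v c := by
    rw [← padicValInt_sq, h.kum,
      show 16 * (a * b * c * d) = 2 ^ 2 * (2 ^ 2 * (a * b * c * d)) by ring,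
      padicValInt.mul (by positivity) (by positivity), padicValInt.mul (by positivity)
      (by positivity), padicValInt.mul (by positivity) (by positivity), padicValInt.mul
      (by positivity) (by positivity), padicValInt.mul (by positivity) (by positivity),
      padicValInt_sq, padicValInt_two_of_odd hp2, hvb, hvd]
    ring
  have hrX : (p : ℤ) ^ r ∣ qf b d - qf a c :=
    (padicValInt_dvd_iff _ _).2 (Or.inr (by omega))
  have hpar : qf (b + a) (d + c) + qf (b - a) (d - c) = 2 * (qf b d - qf a c + 2 * qf a c) := by
    simp only [qf]; ring
  have hrs : (p : ℤ) ^ r ∣ qf (b + a) (d + c) + qf (b - a) (d - c) := by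
    rw [hpar]
    exact ((dvd_add hrX (((dvd_pow_self _ two_ne_zero).trans hr2).mul_left 2))).mul_left 2
  have hrad : r ≤ v (a * d + b * c) := by
    have : (p : ℤ) ^ r ∣ a * d + b * c := dvd_add (hra.mul_right d) (hrc.mul_left b)
    exact ((padicValInt_dvd_iff _ _).1 this).resolve_left (by positivity)
  have hrm : r ≤ v (qf (b - a) (d - c)) := by
    by_contra hlt
    have h1 : (p : ℤ) ^ r ∣ qf (b + a) (d + c) := (padicValInt_dvd_iff _ _).2 (Or.inr (by omega))
    have h2 := (dvd_add_right h1).1 hrs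
    exact hlt (((padicValInt_dvd_iff _ _).1 h2).resolve_left hm.ne')
  have hrp : r ≤ v (qf (b + a) (d + c)) := by
    have h1 : (p : ℤ) ^ r ∣ qf (b - a) (d - c) := (padicValInt_dvd_iff _ _).2 (Or.inr hrm)
    have h2 := (dvd_add_left h1).1 hrs
    exact ((padicValInt_dvd_iff _ _).1 h2).resolve_left hpl.ne'
  obtain ⟨e, he⟩ := hevm
  obtain ⟨f, hf⟩ := hro
  have hrm' : r + 1 ≤ v (qf (b - a) (d - c)) := by omega
  have hrp' : r + 1 ≤ v (qf (b + a) (d + c)) := by omega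
  have hd1 : (p : ℤ) ^ (r + 1) ∣ 2 * (qf b d - qf a c + 2 * qf a c) := by
    rw [← hpar]
    exact dvd_add ((padicValInt_dvd_iff _ _).2 (Or.inr hrp'))
      ((padicValInt_dvd_iff _ _).2 (Or.inr hrm'))
  have hr2' : (p : ℤ) ^ (r + 1) ∣ 2 * qf a c := by
    refine ((pow_dvd_pow _ ?_).trans (pow_mul (p : ℤ) r 2 ▸ hr2)).mul_left 2
    omega
  have hcop : IsCoprime ((p : ℤ) ^ (r + 1)) 2 :=
    (prime_int.coprime_iff_not_dvd.2 (not_dvd_two hp2)).pow_left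
  have hd2 := (dvd_add_left hr2').1 (hcop.dvd_of_dvd_mul_left hd1)
  have hd3 := ((padicValInt_dvd_iff _ _).1 hd2).resolve_left hX0
  have hd4 : (p : ℤ) ^ (r + 1) ∣ a * d + b * c :=
    (padicValInt_dvd_iff _ _).2 (Or.inr (by omega))
  rcases lt_trichotomy (v a) (v c) with hlt | heq | hlt
  · have h1 : (p : ℤ) ^ (r + 1) ∣ b * c :=
      ((padicValInt_dvd_iff _ _).2 (Or.inr (by omega)) : (p : ℤ) ^ (r + 1) ∣ c).mul_left b
    have h2 := ((padicValInt_dvd_iff _ _).1 ((dvd_add_left h1).1 hd4)).resolve_left (by positivity)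
    rw [padicValInt.mul (by positivity) (by positivity)] at h2
    omega
  · omega
  · have h1 : (p : ℤ) ^ (r + 1) ∣ a * d :=
      ((padicValInt_dvd_iff _ _).2 (Or.inr (by omega)) : (p : ℤ) ^ (r + 1) ∣ a).mul_right d
    have h2 := ((padicValInt_dvd_iff _ _).1 ((dvd_add_right h1).1 hd4)).resolve_left
      (by positivity)
    rw [padicValInt.mul (by positivity) (by positivity)] at h2
    omega

theorem even_val_of_odd_prime (h : PrimPoint a b c d) (hp2 : p ≠ 2) : Even (v a + v b) := by
  by_contra hodd
  have ha0 := h.ha; have hb0 := h.hb; have hc0 := h.hc; have hd0 := h.hd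
  have hprod := h.even_val_prod (p := p)
  have hA := padicValInt_pos_iff (p := p) ha0.ne'
  have hB := padicValInt_pos_iff (p := p) hb0.ne'
  have hC := padicValInt_pos_iff (p := p) hc0.ne'
  have hD := padicValInt_pos_iff (p := p) hd0.ne'
  rw [Nat.not_even_iff_odd] at hodd
  have hodd' : Odd (v c + v d) := by
    rw [← Nat.not_even_iff_odd] at hodd ⊢
    rw [add_assoc, Nat.even_add] at hprod
    tauto
  have hab : ¬ ((p : ℤ) ∣ a ∧ (p : ℤ) ∣ b) := fun ⟨h1, h2⟩ => by
    obtain ⟨h3, h4⟩ := h.not_dvd_of_dvd_left h1 h2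
    rw [padicValInt.eq_zero_of_not_dvd h3, padicValInt.eq_zero_of_not_dvd h4] at hodd'
    exact absurd hodd' (by decide)
  have hcd : ¬ ((p : ℤ) ∣ c ∧ (p : ℤ) ∣ d) := fun ⟨h1, h2⟩ => by
    obtain ⟨h3, h4⟩ := h.not_dvd_of_dvd_right hp2 h1 h2
    rw [padicValInt.eq_zero_of_not_dvd h3, padicValInt.eq_zero_of_not_dvd h4] at hodd
    exact absurd hodd (by decide)
  have hab' : (p : ℤ) ∣ a ∨ (p : ℤ) ∣ b := by
    rw [← hA, ← hB]; obtain ⟨k, hk⟩ := hodd; omega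
  have hcd' : (p : ℤ) ∣ c ∨ (p : ℤ) ∣ d := by
    rw [← hC, ← hD]; obtain ⟨k, hk⟩ := hodd'; omega
  rcases hab' with h1 | h1 <;> rcases hcd' with h2 | h2
  · have h3 : ¬ (p : ℤ) ∣ b := fun h3 => hab ⟨h1, h3⟩
    have h4 : ¬ (p : ℤ) ∣ d := fun h4 => hcd ⟨h2, h4⟩
    rw [padicValInt.eq_zero_of_not_dvd h3] at hodd
    rw [padicValInt.eq_zero_of_not_dvd h4] at hodd'
    exact h.not_odd_of_dvd_ac hp2 h3 h4 hodd hodd'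
  · have h3 : ¬ (p : ℤ) ∣ b := fun h3 => hab ⟨h1, h3⟩
    have h4 : ¬ (p : ℤ) ∣ c := fun h4 => hcd ⟨h4, h2⟩
    exact (Nat.not_even_iff_odd.2 hodd) (h.even_of_dvd_ad hp2 h1 h2 h3 h4)
  · have h3 : ¬ (p : ℤ) ∣ a := fun h3 => hab ⟨h3, h1⟩
    have h4 : ¬ (p : ℤ) ∣ d := fun h4 => hcd ⟨h2, h4⟩
    rw [add_comm] at hodd
    exact (Nat.not_even_iff_odd.2 hodd) (h.symm.even_of_dvd_ad hp2 h1 h2 h3 h4)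
  · have h3 : ¬ (p : ℤ) ∣ a := fun h3 => hab ⟨h3, h1⟩
    have h4 : ¬ (p : ℤ) ∣ c := fun h4 => hcd ⟨h4, h2⟩
    rw [padicValInt.eq_zero_of_not_dvd h3, zero_add] at hodd
    rw [padicValInt.eq_zero_of_not_dvd h4, zero_add] at hodd'
    exact h.symm.not_odd_of_dvd_ac hp2 h3 h4 hodd hodd'

theorem four_dvd (h : PrimPoint a b c d) : (4 : ℤ) ∣ qf b d - qf a c := by
  rw [← Int.pow_dvd_pow_iff two_ne_zero]
  exact ⟨a * b * c * d, by rw [h.kum]; ring⟩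

theorem even_or_odd_of_two (h : PrimPoint a b c d) (hc : (2 : ℤ) ∣ c) (hd : (2 : ℤ) ∣ d)
    (ha : ¬ (2 : ℤ) ∣ a) : ¬ (2 : ℤ) ∣ b := by
  rintro ⟨b, rfl⟩
  obtain ⟨c, rfl⟩ := hc
  obtain ⟨d, rfl⟩ := hd
  obtain ⟨a, rfl⟩ : ∃ k, a = 2 * k + 1 := ⟨a / 2, by omega⟩
  obtain ⟨e, he⟩ := h.four_dvd
  simp only [qf] at he
  ring_nf at he
  omega

theorem even_val_two (h : PrimPoint a b c d) : Even (padicValInt 2 a + padicValInt 2 b) := by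
  have : Fact (Nat.Prime 2) := ⟨Nat.prime_two⟩
  by_contra hodd
  have hprod := h.even_val_prod (p := 2)
  rw [Nat.not_even_iff_odd] at hodd
  have hodd' : Odd (padicValInt 2 c + padicValInt 2 d) := by
    rw [← Nat.not_even_iff_odd] at hodd ⊢
    rw [add_assoc, Nat.even_add] at hprod
    tauto
  have hX : (2 : ℤ) ∣ qf b d - qf a c := Dvd.dvd.trans (by decide) h.four_dvd
  have hcd : (2 : ℤ) ∣ c ↔ (2 : ℤ) ∣ d := by
    have h1 : (2 : ℤ) ∣ d ^ 2 - c ^ 2 := by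
      obtain ⟨e, he⟩ := hX
      simp only [qf] at he
      exact ⟨e + b * d - b ^ 2 - a * c + a ^ 2, by linear_combination he⟩
    constructor <;> intro h2
    · exact Int.prime_two.dvd_of_dvd_pow (n := 2) ((dvd_sub_left (dvd_pow h2 two_ne_zero)).1 h1)
    · exact Int.prime_two.dvd_of_dvd_pow (n := 2) ((dvd_sub_right (dvd_pow h2 two_ne_zero)).1 h1)
  by_cases hc : (2 : ℤ) ∣ c
  · have hd := hcd.1 hc
    by_cases ha : (2 : ℤ) ∣ a
    · by_cases hb : (2 : ℤ) ∣ b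
      · exact h.prim 2 Nat.prime_two ha hb hc hd
      · exact h.symm.even_or_odd_of_two hd hc hb ha
    · have hb := h.even_or_odd_of_two hc hd ha
      rw [padicValInt.eq_zero_of_not_dvd (p := 2) ha,
        padicValInt.eq_zero_of_not_dvd (p := 2) hb] at hodd
      exact absurd hodd (by decide)
  · rw [padicValInt.eq_zero_of_not_dvd (p := 2) hc,
      padicValInt.eq_zero_of_not_dvd (p := 2) (fun hd => hc (hcd.2 hd))] at hodd'
    exact absurd hodd' (by decide)

theorem even_val_left (h : PrimPoint a b c d) : Even (v a + v b) := by
  by_cases hp2 : p = 2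
  · subst hp2
    exact h.even_val_two
  · exact h.even_val_of_odd_prime hp2

theorem even_val_right (h : PrimPoint a b c d) : Even (v c + v d) := by
  have hprod := h.even_val_prod (p := p)
  rw [add_assoc, Nat.even_add] at hprod
  exact hprod.1 h.even_val_left

theorem even_val_ac (h : PrimPoint a b c d) (hp2 : p ≠ 2) : Even (v a + v c) := by
  by_contra hodd
  have ha0 := h.ha; have hb0 := h.hb; have hc0 := h.hc; have hd0 := h.hd
  have hl := h.even_val_left (p := p)
  have hr := h.even_val_right (p := p)
  have hq := h.even_val_lift_left hp2
  have hs := h.val_qf_add hp2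
  rw [Nat.even_iff] at hodd hl hr hq
  have hpm : (p : ℤ) ∣ qf (b - a) (d - c) :=
    (padicValInt_pos_iff h.qf_sub_pos.ne').1 (by omega)
  have hpp : (p : ℤ) ∣ qf (b + a) (d + c) :=
    (padicValInt_pos_iff h.qf_add_pos.ne').1 (by omega)
  have hsum := (dvd_add hpp hpm)
  have h2 := not_dvd_two (p := p) hp2
  rcases Nat.mod_two_eq_zero_or_one (v a) with h0 | h1
  · have hc : (p : ℤ) ∣ c := (padicValInt_pos_iff hc0.ne').1 (by omega)
    have hd : (p : ℤ) ∣ d := (padicValInt_pos_iff hd0.ne').1 (by omega)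
    have hsq := h.dvd_sq_sub_sq' hp2 hc hd
    obtain ⟨ha, -⟩ := h.not_dvd_of_dvd_right hp2 hc hd
    obtain ⟨c, rfl⟩ := hc
    obtain ⟨d, rfl⟩ := hd
    obtain ⟨e, he⟩ := hsum
    obtain ⟨f, hf⟩ := hsq
    simp only [qf] at he
    have : (p : ℤ) ∣ 2 * (2 * (2 * a ^ 2)) :=
      ⟨e - 4 * f - 2 * p * (d ^ 2 + c ^ 2) + 4 * b * d + 4 * a * c, by
        linear_combination he - 4 * hf⟩
    have := (prime_int.dvd_or_dvd this).resolve_left h2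
    have := (prime_int.dvd_or_dvd this).resolve_left h2
    have := (prime_int.dvd_or_dvd this).resolve_left h2
    exact ha (prime_int.dvd_of_dvd_pow this)
  · have ha : (p : ℤ) ∣ a := (padicValInt_pos_iff ha0.ne').1 (by omega)
    have hb : (p : ℤ) ∣ b := (padicValInt_pos_iff hb0.ne').1 (by omega)
    have hsq := h.dvd_sq_sub_sq ha hb
    obtain ⟨hc, -⟩ := h.not_dvd_of_dvd_left ha hb
    obtain ⟨a, rfl⟩ := ha
    obtain ⟨b, rfl⟩ := hb
    obtain ⟨e, he⟩ := hsum
    obtain ⟨f, hf⟩ := hsq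
    simp only [qf] at he
    have : (p : ℤ) ∣ 2 * (2 * c ^ 2) :=
      ⟨e - 2 * f - 4 * p * (a ^ 2 + b ^ 2) + 4 * b * d + 4 * a * c, by
        linear_combination he - 2 * hf⟩
    have := (prime_int.dvd_or_dvd this).resolve_left h2
    have := (prime_int.dvd_or_dvd this).resolve_left h2
    exact hc (prime_int.dvd_of_dvd_pow this)

end PrimPoint

/-- The descent equations: integral data expressing that the point
`(2 * p ^ 2 : 2 * q ^ 2 : r ^ 2 : t ^ 2)` lies on the Kummer surface and lifts to the Jacobian. -/
structure IsSol (p q r t w : ℤ) : Prop where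
  hp : p ≠ 0
  hq : q ≠ 0
  hr : r ≠ 0
  ht : t ≠ 0
  kum : qf (2 * q ^ 2) (t ^ 2) - qf (2 * p ^ 2) (r ^ 2) = 8 * p * q * r * t
  lift : qf (2 * q ^ 2 - 2 * p ^ 2) (t ^ 2 - r ^ 2) = w ^ 2

theorem IsSol.of_sq {p q r t w : ℤ} (hp : p ≠ 0) (hq : q ≠ 0) (hr : r ≠ 0) (ht : t ≠ 0)
    (kum : (qf (2 * q ^ 2) (t ^ 2) - qf (2 * p ^ 2) (r ^ 2)) ^ 2 = (8 * p * q * r * t) ^ 2)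
    (lift : qf (2 * q ^ 2 - 2 * p ^ 2) (t ^ 2 - r ^ 2) = w ^ 2) :
    IsSol p q r t w ∨ IsSol (-p) q r t w := by
  rcases sq_eq_sq_iff_eq_or_eq_neg.1 kum with h | h
  · exact Or.inl ⟨hp, hq, hr, ht, h, lift⟩
  · exact Or.inr ⟨neg_ne_zero.2 hp, hq, hr, ht, by rw [neg_sq, h]; ring, by rwa [neg_sq]⟩

theorem exists_coprime_sq_of_mul_even {a b : ℤ} (ha : 0 < a) (hb : 0 < b)
    (h : ∀ p : ℕ, ∀ _ : Fact p.Prime, Even (padicValInt p a + padicValInt p b)) :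
    ∃ g x y : ℤ, 0 < g ∧ x ≠ 0 ∧ y ≠ 0 ∧ a = g * x ^ 2 ∧ b = g * y ^ 2 := by
  obtain ⟨m, hm⟩ := exists_sq_of_even_padicValInt (mul_pos ha hb) fun p hp => by
    rw [padicValInt.mul ha.ne' hb.ne']; exact h p hp
  have hg0 : 0 < Int.gcd a b := Int.gcd_pos_of_ne_zero_left b ha.ne'
  have hg : (0 : ℤ) < Int.gcd a b := by exact_mod_cast hg0
  obtain ⟨x, hx⟩ := Int.gcd_dvd_left a b
  obtain ⟨y, hy⟩ := Int.gcd_dvd_right a b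
  have hcop : IsCoprime x y := by
    refine ⟨Int.gcdA a b, Int.gcdB a b, mul_left_cancel₀ hg.ne' ?_⟩
    linear_combination -Int.gcd_eq_gcd_ab a b - Int.gcdA a b * hx - Int.gcdB a b * hy
  generalize (Int.gcd a b : ℤ) = g at *
  subst hx hy
  have hx0 : 0 < x := pos_of_mul_pos_right ha hg.le
  have hy0 : 0 < y := pos_of_mul_pos_right hb hg.le
  obtain ⟨n, rfl⟩ : g ∣ m := by
    rw [← Int.pow_dvd_pow_iff two_ne_zero]
    exact ⟨x * y, by rw [← hm]; ring⟩
  have hxy : x * y = n ^ 2 := by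
    apply mul_left_cancel₀ (pow_ne_zero 2 hg.ne')
    linear_combination hm
  obtain ⟨u, rfl⟩ := Int.exists_sq_of_coprime_mul_pos hcop hx0 hxy
  obtain ⟨v, rfl⟩ := Int.exists_sq_of_coprime_mul_pos hcop.symm hy0 (by rw [mul_comm]; exact hxy)
  exact ⟨g, u, v, hg, by rintro rfl; simp at hx0, by rintro rfl; simp at hy0, rfl, rfl⟩

theorem PrimPoint.exists_isSol {a b c d : ℤ} (h : PrimPoint a b c d) :
    ∃ p q r t w : ℤ, IsSol p q r t w ∧
      2 * p ^ 2 + 2 * q ^ 2 + r ^ 2 + t ^ 2 ≤ 2 * (c + d) + 4 * (a + b) := by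
  have key : ∃ p q r t w : ℤ, (IsSol p q r t w ∨ IsSol (-p) q r t w) ∧
      2 * p ^ 2 + 2 * q ^ 2 + r ^ 2 + t ^ 2 ≤ 2 * (c + d) + 4 * (a + b) := by
    obtain ⟨g, x, y, hg, hx, hy, rfl, rfl⟩ :=
      exists_coprime_sq_of_mul_even h.ha h.hb fun p hp => h.even_val_left
    obtain ⟨k, z, u, hk, hz, hu, rfl, rfl⟩ :=
      exists_coprime_sq_of_mul_even h.hc h.hd fun p hp => h.even_val_right
    have hgk : ∀ p : ℕ, p.Prime → (p : ℤ) ∣ g → (p : ℤ) ∣ k → False := fun p hp h1 h2 =>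
      h.prim p hp (h1.mul_right _) (h1.mul_right _) (h2.mul_right _) (h2.mul_right _)
    have hpar : ∀ p : ℕ, ∀ _ : Fact p.Prime, p ≠ 2 →
        Even (padicValInt p g) ∧ Even (padicValInt p k) := fun p hp hp2 => by
      have h1 := h.even_val_ac hp2
      rw [padicValInt.mul hg.ne' (pow_ne_zero 2 hx), padicValInt.mul hk.ne' (pow_ne_zero 2 hz),
        padicValInt_sq, padicValInt_sq, Nat.even_iff] at h1
      have h2 : padicValInt p g = 0 ∨ padicValInt p k = 0 := by
        by_contra! h3
        exact hgk p hp.out ((padicValInt_pos_iff hg.ne').1 (Nat.pos_of_ne_zero h3.1))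
          ((padicValInt_pos_iff hk.ne').1 (Nat.pos_of_ne_zero h3.2))
      rw [Nat.even_iff, Nat.even_iff]
      omega
    obtain ⟨e, he⟩ := exists_sq_or_two_mul_sq hg fun p hp hp2 => (hpar p hp hp2).1
    obtain ⟨f, hf⟩ := exists_sq_or_two_mul_sq hk fun p hp hp2 => (hpar p hp hp2).2
    have he0 : e ≠ 0 := by rintro rfl; simp at he; exact hg.ne' he
    have hf0 : f ≠ 0 := by rintro rfl; simp at hf; exact hk.ne' hf
    obtain ⟨s, hs⟩ := h.lift_left
    have hkum := h.kum
    rcases he with rfl | rfl <;> rcases hf with rfl | rfl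
    · obtain ⟨w, rfl⟩ : e * x * (f * z) ∣ s := by
        rw [← Int.pow_dvd_pow_iff two_ne_zero, ← hs]
        exact ⟨2 * qf (e ^ 2 * y ^ 2 - e ^ 2 * x ^ 2) (f ^ 2 * u ^ 2 - f ^ 2 * z ^ 2), by ring⟩
      have hw : 2 * qf (e ^ 2 * y ^ 2 - e ^ 2 * x ^ 2) (f ^ 2 * u ^ 2 - f ^ 2 * z ^ 2) = w ^ 2 := by
        apply mul_left_cancel₀ (a := (e * x * (f * z)) ^ 2) (by positivity)
        linear_combination hs
      refine ⟨f * z, f * u, 2 * (e * x), 2 * (e * y), 2 * w, IsSol.of_sq (by positivity)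
        (by positivity) (by positivity) (by positivity) ?_ ?_, by nlinarith⟩
      · simp only [qf] at hkum ⊢
        linear_combination 64 * hkum
      · simp only [qf] at hw ⊢
        linear_combination 4 * hw
    · obtain ⟨w, rfl⟩ : 2 * (e * x * (f * z)) ∣ s := by
        rw [← Int.pow_dvd_pow_iff two_ne_zero, ← hs]
        exact ⟨qf (e ^ 2 * y ^ 2 - e ^ 2 * x ^ 2) (2 * f ^ 2 * u ^ 2 - 2 * f ^ 2 * z ^ 2), by ring⟩
      have hw : qf (e ^ 2 * y ^ 2 - e ^ 2 * x ^ 2) (2 * f ^ 2 * u ^ 2 - 2 * f ^ 2 * z ^ 2) =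
          w ^ 2 := by
        apply mul_left_cancel₀ (a := (2 * (e * x * (f * z))) ^ 2) (by positivity)
        linear_combination hs
      refine ⟨e * x, e * y, 2 * (f * z), 2 * (f * u), 2 * w, IsSol.of_sq (by positivity)
        (by positivity) (by positivity) (by positivity) ?_ ?_, by
          nlinarith [sq_nonneg (e * x), sq_nonneg (e * y)]⟩
      · simp only [qf] at hkum ⊢
        linear_combination 16 * hkum
      · simp only [qf] at hw ⊢
        linear_combination 4 * hw
    · obtain ⟨w, rfl⟩ : 2 * (e * x * (f * z)) ∣ s := by
        rw [← Int.pow_dvd_pow_iff two_ne_zero, ← hs]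
        exact ⟨qf (2 * e ^ 2 * y ^ 2 - 2 * e ^ 2 * x ^ 2) (f ^ 2 * u ^ 2 - f ^ 2 * z ^ 2), by ring⟩
      have hw : qf (2 * e ^ 2 * y ^ 2 - 2 * e ^ 2 * x ^ 2) (f ^ 2 * u ^ 2 - f ^ 2 * z ^ 2) =
          w ^ 2 := by
        apply mul_left_cancel₀ (a := (2 * (e * x * (f * z))) ^ 2) (by positivity)
        linear_combination hs
      refine ⟨e * x, e * y, f * z, f * u, w, IsSol.of_sq (by positivity)
        (by positivity) (by positivity) (by positivity) ?_ ?_, by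
          nlinarith [sq_nonneg (e * x), sq_nonneg (e * y), sq_nonneg (f * z), sq_nonneg (f * u)]⟩
      · simp only [qf] at hkum ⊢
        linear_combination hkum
      · simp only [qf] at hw ⊢
        linear_combination hw
    · exact (hgk 2 Nat.prime_two ⟨e ^ 2, rfl⟩ ⟨f ^ 2, rfl⟩).elim
  obtain ⟨p, q, r, t, w, h1 | h1, h2⟩ := key
  · exact ⟨p, q, r, t, w, h1, h2⟩
  · exact ⟨-p, q, r, t, w, h1, by rwa [neg_sq]⟩

/-- Boolean form of `no_small_solution`, evaluated by the kernel. -/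
theorem no_small_solution_all : ((List.range 16).all fun i => (List.range 16).all fun j =>
    (List.range 23).all fun k => (List.range 23).all fun l =>
      let p := i + 1; let q := j + 1; let r := k + 1; let t := l + 1
      let x := t ^ 4 + 8 * q ^ 4 + 4 * p ^ 2 * r ^ 2
      let y := r ^ 4 + 8 * p ^ 4 + 4 * q ^ 2 * t ^ 2
      !(Nat.beq x (y + 8 * p * q * r * t)) ||
        Nat.ble 544 (2 * p ^ 2 + 2 * q ^ 2 + r ^ 2 + t ^ 2)) = true := by
  decide +kernel

theorem qf_nonneg {R : Type*} [CommRing R] [LinearOrder R] [IsStrictOrderedRing R] (a c : R) :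
    0 ≤ qf a c := by
  unfold qf
  nlinarith [sq_nonneg (c - a), sq_nonneg a]

theorem qf_eq_zero {R : Type*} [CommRing R] [LinearOrder R] [IsStrictOrderedRing R] {a c : R}
    (h : qf a c = 0) : a = 0 ∧ c = 0 := by
  unfold qf at h
  have ha : a = 0 := by
    rw [← sq_eq_zero_iff]; nlinarith [sq_nonneg (c - a), sq_nonneg a]
  refine ⟨ha, ?_⟩
  subst ha
  rw [← sq_eq_zero_iff]; linarith

theorem PrimPoint.of_pos {a b c d s : ℤ} (ha : 0 < a) (hb : 0 < b) (hc : 0 < c) (hd : 0 < d)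
    (prim : ∀ p : ℕ, p.Prime → (p : ℤ) ∣ a → (p : ℤ) ∣ b → (p : ℤ) ∣ c → (p : ℤ) ∣ d → False)
    (kum : (qf b d - qf a c) ^ 2 = 16 * (a * b * c * d))
    (hQ : qf (b - a) (d - c) ≠ 0)
    (lift : 2 * a * c * qf (b - a) (d - c) = s ^ 2) : PrimPoint a b c d := by
  refine ⟨ha, hb, hc, hd, prim, kum, ⟨s, lift⟩, ?_⟩
  obtain ⟨e, he⟩ : (4 : ℤ) ∣ qf b d - qf a c := by
    rw [← Int.pow_dvd_pow_iff two_ne_zero, kum]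
    exact ⟨a * b * c * d, by ring⟩
  have he2 : e ^ 2 = a * b * c * d := by rw [he] at kum; linarith
  obtain ⟨m, hm⟩ : s ∣ 2 * e * qf (b - a) (d - c) := by
    rw [← Int.pow_dvd_pow_iff two_ne_zero, ← lift]
    exact ⟨2 * b * d * qf (b - a) (d - c), by
      linear_combination 4 * qf (b - a) (d - c) ^ 2 * he2⟩
  refine ⟨m, ?_⟩
  apply mul_left_cancel₀ (a := 2 * a * c * qf (b - a) (d - c)) (by positivity)
  calc _ = (2 * e * qf (b - a) (d - c)) ^ 2 := by
        linear_combination -4 * qf (b - a) (d - c) ^ 2 * he2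
    _ = _ := by rw [hm, lift]; ring

theorem exists_isSol_of_primitive {a b c d s : ℤ} (ha : a ≠ 0) (hb : b ≠ 0) (hc : c ≠ 0)
    (hd : d ≠ 0)
    (prim : ∀ p : ℕ, p.Prime → (p : ℤ) ∣ a → (p : ℤ) ∣ b → (p : ℤ) ∣ c → (p : ℤ) ∣ d → False)
    (kum : (qf b d - qf a c) ^ 2 = 16 * (a * b * c * d))
    (lift : 2 * a * c * qf (b - a) (d - c) = s ^ 2) :
    ∃ p q r t w, IsSol p q r t w ∧
      2 * p ^ 2 + 2 * q ^ 2 + r ^ 2 + t ^ 2 ≤ 2 * (|c| + |d|) + 4 * (|a| + |b|) := by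
  have hprod : a * b * c * d ≠ 0 := by simp [ha, hb, hc, hd]
  have hX : qf b d - qf a c ≠ 0 := by
    intro h; rw [h] at kum; exact hprod (by linarith)
  have hmul := PrimPoint.qf_add_mul_qf_sub kum
  have hQ : qf (b - a) (d - c) ≠ 0 := by
    intro h
    obtain ⟨h1, h2⟩ := qf_eq_zero h
    obtain rfl : b = a := by linarith
    obtain rfl : d = c := by linarith
    exact hX (sub_self _)
  have hQ' : qf (b + a) (d + c) ≠ 0 := by
    intro h
    obtain ⟨h1, h2⟩ := qf_eq_zero h
    obtain rfl : b = -a := by linarith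
    obtain rfl : d = -c := by linarith
    exact hX (by simp only [qf]; ring)
  have hQp : 0 < qf (b - a) (d - c) := lt_of_le_of_ne (qf_nonneg _ _) hQ.symm
  have hac : 0 < a * c := by
    refine lt_of_le_of_ne ?_ (mul_ne_zero ha hc).symm
    by_contra hneg
    nlinarith [sq_nonneg s, mul_pos_of_neg_of_neg (not_le.1 hneg) (neg_neg_of_pos hQp)]
  have hbd : 0 < b * d := by
    refine lt_of_le_of_ne ?_ (mul_ne_zero hb hd).symm
    by_contra hneg
    nlinarith [sq_nonneg (qf b d - qf a c),
      mul_pos_of_neg_of_neg (not_le.1 hneg) (neg_neg_of_pos hac)]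
  obtain ⟨m, hm⟩ : ∃ m, 2 * a * c * qf (b + a) (d + c) = m ^ 2 := by
    obtain ⟨m, hm⟩ : qf (b - a) (d - c) ∣ s * (2 * (a * d + b * c)) := by
      rw [← Int.pow_dvd_pow_iff two_ne_zero, mul_pow, ← lift, ← hmul]
      exact ⟨2 * a * c * qf (b + a) (d + c), by ring⟩
    refine ⟨m, ?_⟩
    apply mul_left_cancel₀ (a := qf (b - a) (d - c) ^ 2) (by positivity)
    rw [← mul_pow, ← hm, mul_pow, ← lift, ← hmul]
    ring
  have prim' : ∀ p : ℕ, p.Prime → (p : ℤ) ∣ |a| → (p : ℤ) ∣ |b| → (p : ℤ) ∣ |c| → (p : ℤ) ∣ |d| →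
      False := by simpa only [dvd_abs] using prim
  rcases lt_or_gt_of_ne ha with ha' | ha' <;> rcases lt_or_gt_of_ne hb with hb' | hb'
  · have hc' : c < 0 := neg_of_mul_pos_right hac ha'.le
    have hd' : d < 0 := neg_of_mul_pos_right hbd hb'.le
    rw [abs_of_neg ha', abs_of_neg hb', abs_of_neg hc', abs_of_neg hd'] at prim' ⊢
    refine (PrimPoint.of_pos (s := s) (by linarith) (by linarith) (by linarith) (by linarith)
      prim' ?_ ?_ ?_).exists_isSol
    · simp only [qf] at kum ⊢; linear_combination kum
    · convert hQ using 1; simp only [qf]; ring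
    · simp only [qf] at lift ⊢; linear_combination lift
  · have hc' : c < 0 := neg_of_mul_pos_right hac ha'.le
    have hd' : 0 < d := pos_of_mul_pos_right hbd hb'.le
    rw [abs_of_neg ha', abs_of_pos hb', abs_of_neg hc', abs_of_pos hd'] at prim' ⊢
    refine (PrimPoint.of_pos (s := m) (by linarith) (by linarith) (by linarith) (by linarith)
      prim' ?_ ?_ ?_).exists_isSol
    · simp only [qf] at kum ⊢; linear_combination kum
    · convert hQ' using 1; simp only [qf]; ring
    · simp only [qf] at hm ⊢; linear_combination hm
  · have hc' : 0 < c := pos_of_mul_pos_right hac ha'.le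
    have hd' : d < 0 := neg_of_mul_pos_right hbd hb'.le
    rw [abs_of_pos ha', abs_of_neg hb', abs_of_pos hc', abs_of_neg hd'] at prim' ⊢
    refine (PrimPoint.of_pos (s := m) (by linarith) (by linarith) (by linarith) (by linarith)
      prim' ?_ ?_ ?_).exists_isSol
    · simp only [qf] at kum ⊢; linear_combination kum
    · convert hQ' using 1; simp only [qf]; ring
    · simp only [qf] at hm ⊢; linear_combination hm
  · have hc' : 0 < c := pos_of_mul_pos_right hac ha'.le
    have hd' : 0 < d := pos_of_mul_pos_right hbd hb'.le
    rw [abs_of_pos ha', abs_of_pos hb', abs_of_pos hc', abs_of_pos hd'] at prim' ⊢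
    exact (PrimPoint.of_pos ha' hb' hc' hd' prim' kum hQ lift).exists_isSol

theorem exists_primitive_multiple {a b c d : ℚ} (ha : a ≠ 0) :
    ∃ (l : ℚ) (A B C D : ℤ), l ≠ 0 ∧ (A : ℚ) = l * a ∧ (B : ℚ) = l * b ∧ (C : ℚ) = l * c ∧
      (D : ℚ) = l * d ∧
      ∀ p : ℕ, p.Prime → (p : ℤ) ∣ A → (p : ℤ) ∣ B → (p : ℤ) ∣ C → (p : ℤ) ∣ D → False := by
  obtain ⟨v, hv⟩ : ∃ v : Fin 4 → ℚ, v = ![a, b, c, d] := ⟨_, rfl⟩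
  obtain ⟨n, hn⟩ := IsLocalization.exist_integer_multiples_of_finite (nonZeroDivisors ℤ) v
  choose z hz using hn
  simp only [algebraMap_int_eq, eq_intCast] at hz
  have hn0 : ((n : ℤ) : ℚ) ≠ 0 := by
    have := nonZeroDivisors.coe_ne_zero n
    exact_mod_cast this
  have hz0 : ∃ i ∈ Finset.univ, z i ≠ 0 := by
    refine ⟨0, Finset.mem_univ _, fun h => ?_⟩
    have := hz 0
    rw [h] at this
    simp [hv, ha] at this
  obtain ⟨f, hf, hg⟩ := Finset.extract_gcd z ⟨0, Finset.mem_univ _⟩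
  set g := Finset.univ.gcd z with hgd
  have hg0 : (g : ℚ) ≠ 0 := by
    obtain ⟨i, hi, h⟩ := hz0
    intro h0
    have h0' : g = 0 := by exact_mod_cast h0
    exact h (Finset.gcd_eq_zero_iff.1 h0' i hi)
  have key : ∀ i, (f i : ℚ) = (n : ℤ) / g * v i := by
    intro i
    have h1 := hz i
    rw [hf i (Finset.mem_univ _)] at h1
    push_cast at h1
    rw [Algebra.smul_def] at h1
    simp only [algebraMap_int_eq, eq_intCast] at h1
    field_simp
    linarith
  refine ⟨(n : ℤ) / g, f 0, f 1, f 2, f 3, div_ne_zero hn0 hg0, ?_, ?_, ?_, ?_, ?_⟩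
  · simpa [hv] using key 0
  · simpa [hv] using key 1
  · simpa [hv] using key 2
  · simpa [hv] using key 3
  · intro p hp h0 h1 h2 h3
    have : (p : ℤ) ∣ Finset.univ.gcd f := Finset.dvd_gcd fun i _ => by fin_cases i <;> assumption
    rw [hg] at this
    exact hp.one_lt.ne' (by exact_mod_cast Int.eq_one_of_dvd_one (by positivity) this)

theorem no_diagonal_solution {p r t : ℚ} (hp : p ≠ 0) (hr : r ≠ 0) (ht : t ≠ 0)
    (h : (t ^ 2 - r ^ 2) * (r ^ 2 + t ^ 2 - 4 * p ^ 2) = 8 * p ^ 2 * r * t) : False := by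
  have hH : t ^ 2 - r ^ 2 ≠ 0 := by
    intro h0
    rw [h0, zero_mul] at h
    exact mul_ne_zero (mul_ne_zero (mul_ne_zero (by norm_num) (pow_ne_zero 2 hp)) hr) ht h.symm
  have hplus : t + r ≠ 0 := fun h0 => hH (by linear_combination (t - r) * h0)
  have hminus : t - r ≠ 0 := fun h0 => hH (by linear_combination (t + r) * h0)
  rcases curve_rational_points ((t - r) / (t + r))
      (4 * p * (t ^ 2 - r ^ 2 + 2 * r * t) / (t + r) ^ 3) (by
        field_simp
        linear_combination (-4) * (t ^ 2 - r ^ 2 + 2 * r * t) * h) with h0 | h0 | h0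
  · exact div_ne_zero hminus hplus h0
  · rw [div_eq_iff hplus] at h0
    exact hr (by linarith)
  · rw [div_eq_iff hplus] at h0
    exact ht (by linarith)

namespace IsSol

variable {p q r t w : ℤ}

theorem sq_sub_sq_ne_zero (h : IsSol p q r t w) : p ^ 2 - q ^ 2 ≠ 0 := by
  intro h0
  have hp : (p : ℚ) ≠ 0 := by exact_mod_cast h.hp
  have hr : (r : ℚ) ≠ 0 := by exact_mod_cast h.hr
  have ht : (t : ℚ) ≠ 0 := by exact_mod_cast h.ht
  have hk := h.kum
  simp only [qf] at hk
  rcases sq_eq_sq_iff_eq_or_eq_neg.1 (sub_eq_zero.1 h0) with rfl | rfl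
  · refine no_diagonal_solution hp hr ht ?_
    have : (t ^ 2 - r ^ 2) * (r ^ 2 + t ^ 2 - 4 * p ^ 2) = 8 * p ^ 2 * r * t := by
      linear_combination hk
    exact_mod_cast this
  · have hq : (q : ℚ) ≠ 0 := by exact_mod_cast h.hq
    refine no_diagonal_solution hq hr (neg_ne_zero.2 ht) ?_
    have : ((-t) ^ 2 - r ^ 2) * (r ^ 2 + (-t) ^ 2 - 4 * q ^ 2) = 8 * q ^ 2 * r * (-t) := by
      linear_combination hk
    exact_mod_cast this

theorem w_ne_zero (h : IsSol p q r t w) : w ≠ 0 := by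
  rintro rfl
  have := (qf_eq_zero (h.lift.trans (by norm_num))).1
  exact h.sq_sub_sq_ne_zero (by linarith)

end IsSol

theorem Int.dvd_of_dvd_mul_primitive {u m A B C D : ℤ}
    (prim : ∀ p : ℕ, p.Prime → (p : ℤ) ∣ A → (p : ℤ) ∣ B → (p : ℤ) ∣ C → (p : ℤ) ∣ D → False)
    (k : ℕ) (hA : u ∣ m * A ^ k) (hB : u ∣ m * B ^ k) (hC : u ∣ m * C ^ k) (hD : u ∣ m * D ^ k) :
    u ∣ m := by
  have hg : Nat.gcd (Nat.gcd A.natAbs B.natAbs) (Nat.gcd C.natAbs D.natAbs) = 1 := by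
    by_contra hne
    obtain ⟨p, hp, hdvd⟩ := Nat.exists_prime_and_dvd hne
    simp only [Nat.dvd_gcd_iff] at hdvd
    exact prim p hp (Int.natCast_dvd.2 hdvd.1.1) (Int.natCast_dvd.2 hdvd.1.2)
      (Int.natCast_dvd.2 hdvd.2.1) (Int.natCast_dvd.2 hdvd.2.2)
  simp only [← Int.natAbs_dvd_natAbs, Int.natAbs_mul, Int.natAbs_pow] at *
  have := Nat.dvd_gcd (Nat.dvd_gcd hA hB) (Nat.dvd_gcd hC hD)
  rwa [Nat.gcd_mul_left, Nat.gcd_mul_left, Nat.gcd_mul_left, Nat.pow_gcd_pow, Nat.pow_gcd_pow,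
    Nat.pow_gcd_pow, hg, one_pow, mul_one] at this

theorem half_height_le {u v p q r t w A B C D : ℤ} (hcop : IsCoprime u v) (hv : 0 < v)
    (prim : ∀ p : ℕ, p.Prime → (p : ℤ) ∣ A → (p : ℤ) ∣ B → (p : ℤ) ∣ C → (p : ℤ) ∣ D → False)
    (e1 : v * (A * D + B * C) = u * (p ^ 2 + q ^ 2))
    (e2 : v * (qf B D - qf A C) = u * (2 * (p ^ 2 - q ^ 2)))
    (e3 : v * (2 * (C * D + 2 * A * B)) = u * (r ^ 2 + t ^ 2))
    (e4 : v * (2 * (A * C - B * D)) = u * (r ^ 2 - t ^ 2 - 2 * p ^ 2 + 2 * q ^ 2))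
    (e5 : v ^ 2 * (4 * (A * B * C * D)) = u ^ 2 * (p ^ 2 - q ^ 2) ^ 2)
    (lift : qf (2 * q ^ 2 - 2 * p ^ 2) (t ^ 2 - r ^ 2) = w ^ 2) :
    (C ^ 2 + D ^ 2 + 2 * A ^ 2 + 2 * B ^ 2) ^ 2 ≤
      512 * (2 * p ^ 2 + 2 * q ^ 2 + r ^ 2 + t ^ 2) ^ 2 := by
  have hdvd : ∀ {x y : ℤ}, v * x = u * y → u ∣ x := fun {x y} h =>
    hcop.dvd_of_dvd_mul_left ⟨y, h⟩
  have hdvd2 : ∀ {x y : ℤ}, (v * x) ^ 2 = u ^ 2 * y → u ∣ x := fun {x y} h =>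
    hcop.dvd_of_dvd_mul_left ((Int.pow_dvd_pow_iff two_ne_zero).1 ⟨y, h⟩)
  have d1 := hdvd e1
  have d2 := hdvd e2
  have d3 := hdvd e3
  have d4 := hdvd e4
  have d5 : u ∣ A * D - B * C := hdvd2 (y := (2 * p * q) ^ 2) (by
    linear_combination (v * (A * D + B * C) + u * (p ^ 2 + q ^ 2)) * e1 - e5)
  simp only [qf] at lift
  have d6 : u ∣ 2 * (A * C + B * D) := hdvd2 (y := w ^ 2) (by
    linear_combination (v * (2 * (A * C - B * D)) +
      u * (r ^ 2 - t ^ 2 - 2 * p ^ 2 + 2 * q ^ 2)) * e4 + 4 * e5 + u ^ 2 * lift)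
  have d7 : u ∣ 2 * (C * D - 2 * A * B) :=
    hdvd2 (y := (r ^ 2 + t ^ 2) ^ 2 - 8 * (p ^ 2 - q ^ 2) ^ 2) (by
      linear_combination (v * (2 * (C * D + 2 * A * B)) + u * (r ^ 2 + t ^ 2)) * e3 - 8 * e5)
  have hu : u ∣ 8 := by
    obtain ⟨x1, h1⟩ := d1
    obtain ⟨x2, h2⟩ := d2
    obtain ⟨x3, h3⟩ := d3
    obtain ⟨x4, h4⟩ := d4
    obtain ⟨x5, h5⟩ := d5
    obtain ⟨x6, h6⟩ := d6
    obtain ⟨x7, h7⟩ := d7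
    have k1 : 2 * (A * D) = u * (x1 + x5) := by linear_combination h1 + h5
    have k2 : 2 * (B * C) = u * (x1 - x5) := by linear_combination h1 - h5
    have k3 : 4 * (A * C) = u * (x4 + x6) := by linear_combination h4 + h6
    have k4 : 4 * (B * D) = u * (x6 - x4) := by linear_combination h6 - h4
    have k5 : 4 * (C * D) = u * (x3 + x7) := by linear_combination h3 + h7
    have k6 : 8 * (A * B) = u * (x3 - x7) := by linear_combination h3 - h7
    simp only [qf] at h2
    refine Int.dvd_of_dvd_mul_primitive prim 3 ?_ ?_ ?_ ?_
    · exact ⟨2 * D * (x1 + x5) - D * (x3 - x7) + B * (x3 - x7) - C * (x4 + x6)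
        + 2 * A * (x4 + x6) - 4 * A * x2, by
        linear_combination 2 * D * k1 - D * k6 + B * k6 - C * k3 + 2 * A * k3 - 4 * A * h2⟩
    · exact ⟨-(D * (x6 - x4) - 2 * B * (x6 - x4) - 2 * C * (x1 - x5) + C * (x3 - x7)
        - A * (x3 - x7) - 4 * B * x2), by
        linear_combination
          -(D * k4 - 2 * B * k4 - 2 * C * k2 + C * k6 - A * k6 - 4 * B * h2)⟩
    · exact ⟨2 * (D * (x3 + x7) - 2 * B * (x3 + x7) + 4 * B * (x1 - x5) + 2 * C * (x4 + x6)
        - 2 * A * (x4 + x6) - 4 * C * x2), by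
        linear_combination
          2 * (D * k5 - 2 * B * k5 + 4 * B * k2 + 2 * C * k3 - 2 * A * k3 - 4 * C * h2)⟩
    · exact ⟨-2 * (-2 * D * (x6 - x4) + 2 * B * (x6 - x4) - C * (x3 + x7) + 2 * A * (x3 + x7)
        - 4 * A * (x1 + x5) - 4 * D * x2), by
        linear_combination
          (-2) * (-2 * D * k4 + 2 * B * k4 - C * k5 + 2 * A * k5 - 4 * A * k1 - 4 * D * h2)⟩
  have hu8 : u ^ 2 ≤ 64 := by
    have := Int.le_of_dvd (by norm_num) (Int.pow_dvd_pow_iff (n := 2) two_ne_zero |>.2 hu)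
    simpa using this
  have hX : v * (D ^ 2 - C ^ 2 + 2 * B ^ 2 - 2 * A ^ 2) =
      u * (4 * (p ^ 2 - q ^ 2) + (t ^ 2 - r ^ 2)) := by
    simp only [qf] at e2
    linear_combination e2 - e4
  have hS : v ^ 2 * (C ^ 2 + D ^ 2 + 2 * A ^ 2 + 2 * B ^ 2) ^ 2 + 8 * (v * (A * C + B * D)) ^ 2 =
      u ^ 2 * ((r ^ 2 + t ^ 2) ^ 2 + (4 * (p ^ 2 - q ^ 2) + (t ^ 2 - r ^ 2)) ^ 2 +
        8 * (p ^ 2 + q ^ 2) ^ 2 + 2 * (r ^ 2 - t ^ 2 - 2 * p ^ 2 + 2 * q ^ 2) ^ 2) := by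
    linear_combination (v * (2 * (C * D + 2 * A * B)) + u * (r ^ 2 + t ^ 2)) * e3 +
      (v * (D ^ 2 - C ^ 2 + 2 * B ^ 2 - 2 * A ^ 2) +
        u * (4 * (p ^ 2 - q ^ 2) + (t ^ 2 - r ^ 2))) * hX +
      8 * (v * (A * D + B * C) + u * (p ^ 2 + q ^ 2)) * e1 +
      2 * (v * (2 * (A * C - B * D)) + u * (r ^ 2 - t ^ 2 - 2 * p ^ 2 + 2 * q ^ 2)) * e4
  have hn : (r ^ 2 + t ^ 2) ^ 2 + (4 * (p ^ 2 - q ^ 2) + (t ^ 2 - r ^ 2)) ^ 2 +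
        8 * (p ^ 2 + q ^ 2) ^ 2 + 2 * (r ^ 2 - t ^ 2 - 2 * p ^ 2 + 2 * q ^ 2) ^ 2 ≤
        8 * (2 * p ^ 2 + 2 * q ^ 2 + r ^ 2 + t ^ 2) ^ 2 := by
    have hp := sq_nonneg p
    have hq := sq_nonneg q
    have hr := sq_nonneg r
    have ht := sq_nonneg t
    generalize p ^ 2 = P at *
    generalize q ^ 2 = Q at *
    generalize r ^ 2 = R at *
    generalize t ^ 2 = T at *
    nlinarith [mul_nonneg hp hq, mul_nonneg hp hr, mul_nonneg hp ht, mul_nonneg hq hr,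
      mul_nonneg hq ht, mul_nonneg hr ht, sq_nonneg R, sq_nonneg T]
  calc (C ^ 2 + D ^ 2 + 2 * A ^ 2 + 2 * B ^ 2) ^ 2
      ≤ v ^ 2 * (C ^ 2 + D ^ 2 + 2 * A ^ 2 + 2 * B ^ 2) ^ 2 :=
        le_mul_of_one_le_left (sq_nonneg _) (by nlinarith)
    _ ≤ u ^ 2 * _ := by rw [← hS]; linarith [sq_nonneg (v * (A * C + B * D))]
    _ ≤ u ^ 2 * _ := mul_le_mul_of_nonneg_left hn (sq_nonneg u)
    _ ≤ 64 * (8 * (2 * p ^ 2 + 2 * q ^ 2 + r ^ 2 + t ^ 2) ^ 2) :=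
        mul_le_mul_of_nonneg_right hu8 (by positivity)
    _ = _ := by ring

theorem no_small_solution {p q r t : ℕ} (hp : 0 < p) (hq : 0 < q) (hr : 0 < r) (ht : 0 < t)
    (h : t ^ 4 + 8 * q ^ 4 + 4 * p ^ 2 * r ^ 2 =
      r ^ 4 + 8 * p ^ 4 + 4 * q ^ 2 * t ^ 2 + 8 * p * q * r * t) :
    543 < 2 * p ^ 2 + 2 * q ^ 2 + r ^ 2 + t ^ 2 := by
  by_contra hn
  have hp' : p ≤ 16 := by nlinarith
  have hq' : q ≤ 16 := by nlinarith
  have hr' : r ≤ 23 := by nlinarith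
  have ht' : t ≤ 23 := by nlinarith
  have := no_small_solution_all
  simp only [List.all_eq_true, List.mem_range] at this
  have := this (p - 1) (by omega) (q - 1) (by omega) (r - 1) (by omega) (t - 1) (by omega)
  rw [Nat.sub_add_cancel hp, Nat.sub_add_cancel hq, Nat.sub_add_cancel hr,
    Nat.sub_add_cancel ht, h, Nat.beq_refl] at this
  simp only [Bool.not_true, Bool.false_or, Nat.ble_eq] at this
  omega

theorem lt_of_height_bounds {m n S : ℤ} (hn : 543 < n) (hm : m ^ 2 ≤ 24 * S)
    (hS : S ^ 2 ≤ 512 * n ^ 2) : m < n := by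
  by_contra! hmn
  have h1 : (m ^ 2) ^ 2 ≤ 294912 * n ^ 2 :=
    (pow_le_pow_left₀ (by positivity) hm 2).trans (by linarith)
  have h2 : (n ^ 2) ^ 2 ≤ (m ^ 2) ^ 2 := by gcongr
  have h3 : n ^ 2 ≤ 294912 := by
    refine le_of_mul_le_mul_right ?_ (show 0 < n ^ 2 by positivity)
    linarith [sq (n ^ 2)]
  nlinarith

theorem exists_primitive_kummer_point {a b c d s : ℚ} (ha : a ≠ 0) (hb : b ≠ 0) (hc : c ≠ 0)
    (hd : d ≠ 0) (kum : (qf b d - qf a c) ^ 2 = 16 * (a * b * c * d))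
    (lift : 2 * a * c * qf (b - a) (d - c) = s ^ 2) :
    ∃ (l : ℚ) (A B C D S : ℤ), A ≠ 0 ∧ B ≠ 0 ∧ C ≠ 0 ∧ D ≠ 0 ∧ (A : ℚ) = l * a ∧
      (B : ℚ) = l * b ∧ (C : ℚ) = l * c ∧ (D : ℚ) = l * d ∧
      (∀ p : ℕ, p.Prime → (p : ℤ) ∣ A → (p : ℤ) ∣ B → (p : ℤ) ∣ C → (p : ℤ) ∣ D → False) ∧
      (qf B D - qf A C) ^ 2 = 16 * (A * B * C * D) ∧
      2 * A * C * qf (B - A) (D - C) = S ^ 2 := by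
  obtain ⟨l, A, B, C, D, hl0, hA, hB, hC, hD, prim⟩ :=
    exists_primitive_multiple (b := b) (c := c) (d := d) ha
  have hne : ∀ {x : ℚ} {X : ℤ}, x ≠ 0 → (X : ℚ) = l * x → X ≠ 0 := by
    rintro x X hx hX rfl
    exact mul_ne_zero hl0 hx (by simpa using hX.symm)
  have hsq : IsSquare (((2 * A * C * qf (B - A) (D - C) : ℤ)) : ℚ) := by
    refine ⟨l ^ 2 * s, ?_⟩
    simp only [qf] at lift ⊢
    push_cast
    rw [hA, hB, hC, hD]
    linear_combination l ^ 4 * lift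
  obtain ⟨S, hS⟩ := Rat.isSquare_intCast_iff.1 hsq
  refine ⟨l, A, B, C, D, S, hne ha hA, hne hb hB, hne hc hC, hne hd hD, hA, hB, hC, hD, prim, ?_,
    hS.trans (sq S).symm⟩
  simp only [qf] at kum ⊢
  qify
  rw [hA, hB, hC, hD]
  linear_combination l ^ 4 * kum

namespace IsSol

variable {p q r t w : ℤ}

theorem height_gt (h : IsSol p q r t w) :
    543 < 2 * p ^ 2 + 2 * q ^ 2 + r ^ 2 + t ^ 2 := by
  have hk := h.kum
  simp only [qf] at hk
  have hp := abs_pos.2 h.hp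
  have hq := abs_pos.2 h.hq
  have hr := abs_pos.2 h.hr
  have ht := abs_pos.2 h.ht
  have habs : |p * q * r * t| = |p| * |q| * |r| * |t| := by simp only [abs_mul]
  have key : ∀ x y z u : ℤ, 0 < |x| → 0 < |y| → 0 < |z| → 0 < |u| →
      u ^ 4 + 8 * y ^ 4 + 4 * x ^ 2 * z ^ 2 =
        z ^ 4 + 8 * x ^ 4 + 4 * y ^ 2 * u ^ 2 + 8 * (|x| * |y| * |z| * |u|) →
      543 < 2 * x ^ 2 + 2 * y ^ 2 + z ^ 2 + u ^ 2 := by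
    intro x y z u hx hy hz hu hxy
    have h4 : ∀ a : ℤ, |a| ^ 4 = a ^ 4 := fun a => Even.pow_abs (by decide) a
    have := no_small_solution (Int.natAbs_pos.2 (abs_pos.1 hx)) (Int.natAbs_pos.2 (abs_pos.1 hy))
      (Int.natAbs_pos.2 (abs_pos.1 hz)) (Int.natAbs_pos.2 (abs_pos.1 hu))
      (by zify; simp only [h4, sq_abs]; linear_combination hxy)
    zify at this
    simpa only [sq_abs] using this
  rcases abs_choice (p * q * r * t) with hc | hc
  · exact key p q r t hp hq hr ht (by rw [← habs, hc]; linear_combination hk)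
  · have := key q p t r hq hp ht hr (by
      rw [show |q| * |p| * |t| * |r| = |p| * |q| * |r| * |t| by ring, ← habs, hc]
      linear_combination -hk)
    linarith

theorem exists_smaller (h : IsSol p q r t w) : ∃ p' q' r' t' w', IsSol p' q' r' t' w' ∧
    2 * p' ^ 2 + 2 * q' ^ 2 + r' ^ 2 + t' ^ 2 < 2 * p ^ 2 + 2 * q ^ 2 + r ^ 2 + t ^ 2 := by
  have hk := h.kum
  have hl := h.lift
  simp only [qf] at hk hl
  obtain ⟨a, b, c, d, k, s, ha, hb, hc, hd, e1, e2, e3, e4, e5, e6⟩ :=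
    exists_kummer_half (p : ℚ) q r t w (by exact_mod_cast h.hp) (by exact_mod_cast h.hq)
      (by exact_mod_cast h.w_ne_zero) (by exact_mod_cast h.sq_sub_sq_ne_zero)
      (by simp only [qf]; exact_mod_cast hk) (by simp only [qf]; exact_mod_cast hl)
  obtain ⟨l, A, B, C, D, S, hA0, hB0, hC0, hD0, hA, hB, hC, hD, prim, kum, lift⟩ :=
    exists_primitive_kummer_point ha hb hc hd (by rw [e2]; linear_combination -4 * e5) e6
  obtain ⟨p', q', r', t', w', hsol, hle⟩ :=
    exists_isSol_of_primitive hA0 hB0 hC0 hD0 prim kum lift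
  refine ⟨p', q', r', t', w', hsol, ?_⟩
  obtain ⟨u, v, hcop, hv, hvk⟩ : ∃ u v : ℤ, IsCoprime u v ∧ 0 < v ∧ (v : ℚ) * (l ^ 2 * k) = u :=
    ⟨(l ^ 2 * k).num, (l ^ 2 * k).den, Int.isCoprime_iff_gcd_eq_one.2 (l ^ 2 * k).reduced,
      Int.natCast_pos.2 (Rat.pos _), by rw [mul_comm]; exact Rat.mul_den_eq_num _⟩
  have hheight := half_height_le (p := p) (q := q) (r := r) (t := t) hcop hv prim
    (by qify; rw [← hvk, hA, hB, hC, hD]; linear_combination v * l ^ 2 * e1)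
    (by
      simp only [qf] at e2 ⊢
      qify; rw [← hvk, hA, hB, hC, hD]; linear_combination v * l ^ 2 * e2)
    (by qify; rw [← hvk, hA, hB, hC, hD]; linear_combination v * l ^ 2 * e3)
    (by qify; rw [← hvk, hA, hB, hC, hD]; linear_combination v * l ^ 2 * e4)
    (by qify; rw [← hvk, hA, hB, hC, hD]; linear_combination v ^ 2 * l ^ 4 * e5)
    h.lift
  have hm : (2 * p' ^ 2 + 2 * q' ^ 2 + r' ^ 2 + t' ^ 2) ^ 2 ≤
      24 * (C ^ 2 + D ^ 2 + 2 * A ^ 2 + 2 * B ^ 2) := by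
    refine (pow_le_pow_left₀ (by positivity) hle 2).trans ?_
    rw [← sq_abs A, ← sq_abs B, ← sq_abs C, ← sq_abs D]
    generalize |A| = x, |B| = y, |C| = z, |D| = u'
    linarith [sq_nonneg (x - y), sq_nonneg (x - z), sq_nonneg (x - u'),
      sq_nonneg (y - z), sq_nonneg (y - u'), sq_nonneg (z - u')]
  exact lt_of_height_bounds h.height_gt hm hheight

end IsSol

/-- The descent equations have no integral solutions. -/
theorem not_isSol (p q r t w : ℤ) : ¬ IsSol p q r t w := by
  intro h
  induction hn : (2 * p ^ 2 + 2 * q ^ 2 + r ^ 2 + t ^ 2).toNat using Nat.strong_induction_on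
    generalizing p q r t w with
  | _ n ih =>
    obtain ⟨p', q', r', t', w', h', hlt⟩ := h.exists_smaller
    have : 0 ≤ 2 * p' ^ 2 + 2 * q' ^ 2 + r' ^ 2 + t' ^ 2 := by positivity
    exact ih _ (by omega) p' q' r' t' w' h' rfl

/-- The Kummer surface has no rational point with nonzero coordinates that lifts to the
Jacobian. -/
theorem no_kummer_point {a b c d s : ℚ} (ha : a ≠ 0) (hb : b ≠ 0) (hc : c ≠ 0) (hd : d ≠ 0)
    (kum : (qf b d - qf a c) ^ 2 = 16 * (a * b * c * d))
    (lift : 2 * a * c * qf (b - a) (d - c) = s ^ 2) : False := by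
  obtain ⟨l, A, B, C, D, S, hA0, hB0, hC0, hD0, -, -, -, -, prim, kum', lift'⟩ :=
    exists_primitive_kummer_point ha hb hc hd kum lift
  obtain ⟨p, q, r, t, w, hsol, -⟩ := exists_isSol_of_primitive hA0 hB0 hC0 hD0 prim kum' lift'
  exact not_isSol _ _ _ _ _ hsol

theorem cubic_third_root {F : Type*} [Field F] {a b c x z : F} (hne : x ≠ z)
    (hx : x ^ 3 + a * x ^ 2 + b * x + c = 0) (hz : z ^ 3 + a * z ^ 2 + b * z + c = 0) :
    (-a - x - z) ^ 3 + a * (-a - x - z) ^ 2 + b * (-a - x - z) + c = 0 := by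
  have hd : x ^ 2 + x * z + z ^ 2 + a * (x + z) + b = 0 := by
    apply mul_left_cancel₀ (sub_ne_zero.2 hne)
    linear_combination hx - hz
  linear_combination hx + (-a - x - z - x) * hd

section Quadratic

variable {K : Type*} [Field K] [NumberField K]

theorem exists_rat_of_fixed (hdeg : Module.finrank ℚ K = 2) {σ : K ≃ₐ[ℚ] K}
    (hσ : σ ≠ AlgEquiv.refl) {z : K} (hz : σ z = z) : ∃ q : ℚ, (q : K) = z := by
  have : Algebra.IsQuadraticExtension ℚ K := ⟨hdeg⟩
  have hcard : Nat.card (K ≃ₐ[ℚ] K) = 2 := (IsGalois.card_aut_eq_finrank ℚ K).trans hdeg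
  obtain ⟨q, hq⟩ := (IsGalois.mem_range_algebraMap_iff_fixed (F := ℚ) z).2 fun τ => by
    rcases eq_or_ne τ 1 with rfl | hτ
    · rfl
    · obtain ⟨a, b, hab, huniv⟩ := Nat.card_eq_two_iff.1 hcard
      have h1 : (1 : K ≃ₐ[ℚ] K) ∈ ({a, b} : Set _) := huniv ▸ Set.mem_univ _
      have h2 : σ ∈ ({a, b} : Set _) := huniv ▸ Set.mem_univ _
      have h3 : τ ∈ ({a, b} : Set _) := huniv ▸ Set.mem_univ _
      have h4 : σ ≠ 1 := hσ
      have h5 : τ = σ := by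
        rcases h1 with rfl | rfl <;> rcases h2 with rfl | rfl <;> rcases h3 with rfl | rfl <;>
          simp_all
      rw [h5, hz]
  exact ⟨q, by rw [← hq]; simp⟩

theorem apply_apply_of_finrank_eq_two (hdeg : Module.finrank ℚ K = 2) (σ : K ≃ₐ[ℚ] K) (z : K) :
    σ (σ z) = z := by
  have : Algebra.IsQuadraticExtension ℚ K := ⟨hdeg⟩
  have hcard : Nat.card (K ≃ₐ[ℚ] K) = 2 := (IsGalois.card_aut_eq_finrank ℚ K).trans hdeg
  have : σ ^ 2 = 1 := by rw [← hcard]; exact pow_card_eq_one'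
  exact DFunLike.congr_fun this z

theorem exists_aut_ne_refl (hdeg : Module.finrank ℚ K = 2) :
    ∃ σ : K ≃ₐ[ℚ] K, σ ≠ AlgEquiv.refl := by
  have : Algebra.IsQuadraticExtension ℚ K := ⟨hdeg⟩
  have hcard : Nat.card (K ≃ₐ[ℚ] K) = 2 := (IsGalois.card_aut_eq_finrank ℚ K).trans hdeg
  have : Nontrivial (K ≃ₐ[ℚ] K) := by
    rw [← Finite.one_lt_card_iff_nontrivial, hcard]; norm_num
  exact exists_ne 1

variable {x y : K}

/-- A quadratic point and its conjugate do not lie on a curve `y = k * (x ^ 2 + 1)`. -/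
theorem not_collinear_left (hdeg : Module.finrank ℚ K = 2) {σ : K ≃ₐ[ℚ] K}
    (hσ : σ ≠ AlgEquiv.refl) (hcurve : y ^ 2 = -x * (x ^ 2 + 1) * (x ^ 2 - 2 * x - 1))
    (hx1 : x ≠ 1) (hxm : x ≠ -1) (hy : y ≠ 0) (hne : x ≠ σ x)
    (h : (x ^ 2 + 1) * σ y = (σ x ^ 2 + 1) * y) : False := by
  have hg : x ^ 2 + 1 ≠ 0 := by
    intro h0
    rw [h0] at hcurve
    exact hy (pow_eq_zero_iff two_ne_zero |>.1 (by linear_combination hcurve))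
  have hg' : σ x ^ 2 + 1 ≠ 0 := by
    have := (map_ne_zero σ).2 hg
    simpa [map_ofNat] using this
  obtain ⟨k, hk⟩ : ∃ k : ℚ, (k : K) = y / (x ^ 2 + 1) := exists_rat_of_fixed hdeg hσ (by
    simp only [map_div₀, map_add, map_pow, map_one]
    rw [div_eq_div_iff hg' hg]
    linear_combination h)
  have hyk : y = k * (x ^ 2 + 1) := by rw [hk, div_mul_cancel₀ _ hg]
  have hcub : x ^ 3 + ((k : K) ^ 2 - 2) * x ^ 2 + (-1) * x + (k : K) ^ 2 = 0 := by
    apply mul_left_cancel₀ hg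
    rw [hyk] at hcurve
    linear_combination hcurve
  have hcub' : σ x ^ 3 + ((k : K) ^ 2 - 2) * σ x ^ 2 + (-1) * σ x + (k : K) ^ 2 = 0 := by
    have := congrArg σ hcub
    simpa [map_ofNat] using this
  have hroot := cubic_third_root hne hcub hcub'
  obtain ⟨q, hq⟩ : ∃ q : ℚ, (q : K) = -((k : K) ^ 2 - 2) - x - σ x :=
    exists_rat_of_fixed hdeg hσ (by simp [apply_apply_of_finrank_eq_two hdeg, map_ofNat]; ring)
  rw [← hq] at hroot
  have hrootQ : q ^ 3 + (k ^ 2 - 2) * q ^ 2 + (-1) * q + k ^ 2 = 0 := by exact_mod_cast hroot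
  have hfactor : k ^ 2 = 1 → False := by
    intro h1
    have h1' : (k : K) ^ 2 = 1 := by exact_mod_cast h1
    have : (x - 1) ^ 2 * (x + 1) = 0 := by rw [h1'] at hcub; linear_combination hcub
    rcases mul_eq_zero.1 this with h2 | h2
    · exact hx1 (sub_eq_zero.1 (pow_eq_zero_iff two_ne_zero |>.1 h2))
    · exact hxm (eq_neg_of_add_eq_zero_left h2)
  rcases curve_rational_points q (k * (q ^ 2 + 1)) (by
    linear_combination (q ^ 2 + 1) * hrootQ) with rfl | rfl | rfl
  · have : k = 0 := pow_eq_zero_iff two_ne_zero |>.1 (by linear_combination hrootQ)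
    exact hy (by rw [hyk, this]; simp)
  · exact hfactor (by linear_combination hrootQ / 2)
  · exact hfactor (by linear_combination hrootQ / 2)

/-- A quadratic point and its conjugate do not lie on a curve `y = k * (x ^ 2 - 2 * x - 1)`. -/
theorem not_collinear_right (hdeg : Module.finrank ℚ K = 2) {σ : K ≃ₐ[ℚ] K}
    (hσ : σ ≠ AlgEquiv.refl) (hcurve : y ^ 2 = -x * (x ^ 2 + 1) * (x ^ 2 - 2 * x - 1))
    (hx1 : x ≠ 1) (hxm : x ≠ -1) (hy : y ≠ 0) (hne : x ≠ σ x)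
    (h : (x ^ 2 - 2 * x - 1) * σ y = (σ x ^ 2 - 2 * σ x - 1) * y) : False := by
  have hg : x ^ 2 - 2 * x - 1 ≠ 0 := by
    intro h0
    rw [h0] at hcurve
    exact hy (pow_eq_zero_iff two_ne_zero |>.1 (by linear_combination hcurve))
  have hg' : σ x ^ 2 - 2 * σ x - 1 ≠ 0 := by
    have := (map_ne_zero σ).2 hg
    simpa [map_ofNat] using this
  obtain ⟨k, hk⟩ : ∃ k : ℚ, (k : K) = y / (x ^ 2 - 2 * x - 1) := exists_rat_of_fixed hdeg hσ (by
    simp only [map_div₀, map_sub, map_mul, map_pow, map_one, map_ofNat]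
    rw [div_eq_div_iff hg' hg]
    linear_combination h)
  have hyk : y = k * (x ^ 2 - 2 * x - 1) := by rw [hk, div_mul_cancel₀ _ hg]
  have hcub : x ^ 3 + (k : K) ^ 2 * x ^ 2 + (1 - 2 * (k : K) ^ 2) * x + -(k : K) ^ 2 = 0 := by
    apply mul_left_cancel₀ hg
    rw [hyk] at hcurve
    linear_combination hcurve
  have hcub' : σ x ^ 3 + (k : K) ^ 2 * σ x ^ 2 + (1 - 2 * (k : K) ^ 2) * σ x + -(k : K) ^ 2 =
      0 := by
    have := congrArg σ hcub
    simpa [map_ofNat] using this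
  have hroot := cubic_third_root hne hcub hcub'
  obtain ⟨q, hq⟩ : ∃ q : ℚ, (q : K) = -(k : K) ^ 2 - x - σ x :=
    exists_rat_of_fixed hdeg hσ (by simp [apply_apply_of_finrank_eq_two hdeg]; ring)
  rw [← hq] at hroot
  have hrootQ : q ^ 3 + k ^ 2 * q ^ 2 + (1 - 2 * k ^ 2) * q + -k ^ 2 = 0 := by
    exact_mod_cast hroot
  have hfactor : k ^ 2 = 1 → False := by
    intro h1
    have h1' : (k : K) ^ 2 = 1 := by exact_mod_cast h1
    have : (x + 1) ^ 2 * (x - 1) = 0 := by rw [h1'] at hcub; linear_combination hcub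
    rcases mul_eq_zero.1 this with h2 | h2
    · exact hxm (eq_neg_of_add_eq_zero_left (pow_eq_zero_iff two_ne_zero |>.1 h2))
    · exact hx1 (sub_eq_zero.1 h2)
  rcases curve_rational_points q (k * (q ^ 2 - 2 * q - 1)) (by
    linear_combination (q ^ 2 - 2 * q - 1) * hrootQ) with rfl | rfl | rfl
  · have : k = 0 := pow_eq_zero_iff two_ne_zero |>.1 (by linear_combination -hrootQ)
    exact hy (by rw [hyk, this]; simp)
  · exact hfactor (by linear_combination -hrootQ / 2)
  · exact hfactor (by linear_combination hrootQ / 2)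

/-- Quadratic points of the curve have rational `x`-coordinate. -/
theorem fixed_of_curve (hdeg : Module.finrank ℚ K = 2) {σ : K ≃ₐ[ℚ] K}
    (hσ : σ ≠ AlgEquiv.refl) (hcurve : y ^ 2 = -x * (x ^ 2 + 1) * (x ^ 2 - 2 * x - 1))
    (hx1 : x ≠ 1) (hxm : x ≠ -1) (hy : y ≠ 0) : σ x = x := by
  by_contra hne'
  have hne : x ≠ σ x := fun h => hne' h.symm
  have hx0 : x ≠ 0 := by
    rintro rfl
    exact hne' (map_zero σ)
  have hσσ := apply_apply_of_finrank_eq_two hdeg σ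
  have hcurve' : σ y ^ 2 = -σ x * (σ x ^ 2 + 1) * (σ x ^ 2 - 2 * σ x - 1) := by
    simpa [map_ofNat] using congrArg σ hcurve
  have hcolg := not_collinear_left hdeg hσ hcurve hx1 hxm hy hne
  have hcolh := not_collinear_right hdeg hσ hcurve hx1 hxm hy hne
  have hx0' : σ x ≠ 0 := (map_ne_zero σ).2 hx0
  have hΔ : x - σ x ≠ 0 := sub_ne_zero.2 hne
  have hΔ' : σ x - x ≠ 0 := sub_ne_zero.2 hne'
  obtain ⟨k2, hk2⟩ : ∃ q : ℚ, (q : K) = x + σ x :=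
    exists_rat_of_fixed hdeg hσ (by simp [hσσ, add_comm])
  obtain ⟨k3, hk3⟩ : ∃ q : ℚ, (q : K) = x * σ x :=
    exists_rat_of_fixed hdeg hσ (by simp [hσσ, mul_comm])
  obtain ⟨k4, hk4⟩ : ∃ q : ℚ, (q : K) = ((x + σ x) + 4 * (x * σ x) + 4 * (x * σ x) ^ 2 -
      (x * σ x) ^ 2 * (x + σ x) - 2 * (y * σ y)) / (x - σ x) ^ 2 :=
    exists_rat_of_fixed hdeg hσ (by
      simp only [map_div₀, map_add, map_sub, map_mul, map_pow, map_ofNat, hσσ]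
      congr 1 <;> ring)
  obtain ⟨s, hs⟩ : ∃ q : ℚ, (q : K) = ((x ^ 2 + 1) * σ y - (σ x ^ 2 + 1) * y) / (x - σ x) :=
    exists_rat_of_fixed hdeg hσ (by
      simp only [map_div₀, map_add, map_sub, map_mul, map_pow, map_one, hσσ]
      rw [div_eq_div_iff hΔ' hΔ]
      ring)
  rw [eq_div_iff (pow_ne_zero 2 hΔ)] at hk4
  rw [eq_div_iff hΔ] at hs
  generalize σ x = x' at *
  generalize σ y = y' at *
  have hγ : (2 + (k4 : K) - k2) * (x - x') ^ 2 * ((x ^ 2 + 1) * (x' ^ 2 + 1)) =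
      ((x ^ 2 + 1) * y' - (x' ^ 2 + 1) * y) ^ 2 := by
    rw [hk2]
    linear_combination ((x ^ 2 + 1) * (x' ^ 2 + 1)) * hk4 - (x ^ 2 + 1) ^ 2 * hcurve' -
      (x' ^ 2 + 1) ^ 2 * hcurve
  have hδ : (2 * (k3 : K) + k4 + k2) * (x - x') ^ 2 *
      ((x ^ 2 - 2 * x - 1) * (x' ^ 2 - 2 * x' - 1)) =
      ((x ^ 2 - 2 * x - 1) * y' - (x' ^ 2 - 2 * x' - 1) * y) ^ 2 := by
    rw [hk2, hk3]
    linear_combination ((x ^ 2 - 2 * x - 1) * (x' ^ 2 - 2 * x' - 1)) * hk4 -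
      (x ^ 2 - 2 * x - 1) ^ 2 * hcurve' - (x' ^ 2 - 2 * x' - 1) ^ 2 * hcurve
  refine no_kummer_point (a := 2) (b := 2 * k3) (c := 2 + k4 - k2) (d := 2 * k3 + k4 + k2)
    (s := 4 * s) two_ne_zero ?_ ?_ ?_ ?_ ?_
  · refine mul_ne_zero two_ne_zero fun h0 => mul_ne_zero hx0 hx0' ?_
    rw [← hk3, h0, Rat.cast_zero]
  · intro h0
    have h0' : (2 + (k4 : K) - k2) = 0 := by exact_mod_cast h0
    rw [h0', zero_mul, zero_mul] at hγ
    exact hcolg (sub_eq_zero.1 (pow_eq_zero_iff two_ne_zero |>.1 hγ.symm))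
  · intro h0
    have h0' : (2 * (k3 : K) + k4 + k2) = 0 := by exact_mod_cast h0
    rw [h0', zero_mul, zero_mul] at hδ
    exact hcolh (sub_eq_zero.1 (pow_eq_zero_iff two_ne_zero |>.1 hδ.symm))
  · simp only [qf]
    apply Rat.cast_injective (α := K)
    push_cast
    apply mul_left_cancel₀ (pow_ne_zero 2 hΔ)
    rw [hk2, hk3]
    linear_combination 16 * ((k4 : K) * (x - x') ^ 2 - ((x + x') + 4 * (x * x') +
      4 * (x * x') ^ 2 - (x * x') ^ 2 * (x + x')) - 2 * (y * y')) * hk4 +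
      64 * y' ^ 2 * hcurve + 64 * (-x * (x ^ 2 + 1) * (x ^ 2 - 2 * x - 1)) * hcurve'
  · simp only [qf]
    apply Rat.cast_injective (α := K)
    push_cast
    apply mul_left_cancel₀ (pow_ne_zero 2 hΔ)
    rw [mul_pow _ (s : K), show (x - x') ^ 2 * (4 ^ 2 * (s : K) ^ 2) =
      16 * ((s : K) * (x - x')) ^ 2 by ring, hs, ← hγ, hk2, hk3]
    ring

end Quadratic

/-- Points of exact period four in terms of the sum `u` and the difference `D` of two opposite
points of the cycle. -/
theorem exists_param_of_exact_period_four {K : Type*} [Field K] [CharZero K] {c α : K}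
    (h : HasExactPeriod c 4 α) :
    ∃ u D : K, D ≠ 0 ∧ u ≠ 0 ∧ u ^ 2 ≠ 1 ∧
      D ^ 2 * u ^ 2 * (u ^ 2 - 1) = (u ^ 2 + 1) * (u ^ 2 + 2 * u - 1) ∧
      c = (-1 / u - (u ^ 2 + D ^ 2) / 2) / 2 ∧ α = (u + D) / 2 ∧ (fc c)^[2] α = (u - D) / 2 := by
  obtain ⟨h4, hlt⟩ := h
  have h2 := hlt 2 (by norm_num) (by norm_num)
  obtain ⟨β, hβ⟩ : ∃ β, α ^ 2 + c = β := ⟨_, rfl⟩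
  obtain ⟨γ, hγ⟩ : ∃ γ, β ^ 2 + c = γ := ⟨_, rfl⟩
  obtain ⟨δ, hδ⟩ : ∃ δ, γ ^ 2 + c = δ := ⟨_, rfl⟩
  simp only [Function.iterate_succ, Function.iterate_zero, Function.comp, fc, id, hβ, hγ, hδ]
    at h4 h2 ⊢
  have hD : α - γ ≠ 0 := sub_ne_zero.2 (Ne.symm h2)
  have huw : (α + γ) * (β + δ) = -1 := by
    apply mul_left_cancel₀ hD
    linear_combination (β + δ) * hβ - (β + δ) * hδ + hγ - h4
  have hu : α + γ ≠ 0 := by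
    intro h0
    rw [h0, zero_mul] at huw
    exact one_ne_zero (by linear_combination huw : (1 : K) = 0)
  have hcurve : (α - γ) ^ 2 * (α + γ) ^ 2 * ((α + γ) ^ 2 - 1) =
      ((α + γ) ^ 2 + 1) * ((α + γ) ^ 2 + 2 * (α + γ) - 1) := by
    have hbd : β - δ = (α - γ) * (α + γ) := by linear_combination hδ - hβ
    have h1 : 2 * (α + γ) - 2 * (β + δ) =
        (β + δ) ^ 2 + ((α - γ) * (α + γ)) ^ 2 - (α + γ) ^ 2 - (α - γ) ^ 2 := by
      rw [← hbd]
      linear_combination 2 * hβ + 2 * hδ - 2 * hγ - 2 * h4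
    linear_combination (-(α + γ) ^ 2) * h1 - (2 * (α + γ) + (α + γ) * (β + δ) - 1) * huw
  refine ⟨α + γ, α - γ, hD, hu, ?_, hcurve, ?_, by ring, by ring⟩
  · intro h0
    rw [h0] at hcurve
    have h3 : α + γ = 0 := by linear_combination (-1 / 4 : K) * hcurve
    exact hu h3
  · have hw : -1 / (α + γ) = β + δ := by rw [div_eq_iff hu, ← huw]; ring
    rw [hw]
    linear_combination (hβ + hδ) / 2

section Quadratic

variable {K : Type*} [Field K] [NumberField K]

theorem conj_param (hdeg : Module.finrank ℚ K = 2) {σ : K ≃ₐ[ℚ] K} (hσ : σ ≠ AlgEquiv.refl)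
    {u D : K} (hD : D ≠ 0) (hu : u ≠ 0) (hu1 : u ^ 2 ≠ 1)
    (h : D ^ 2 * u ^ 2 * (u ^ 2 - 1) = (u ^ 2 + 1) * (u ^ 2 + 2 * u - 1)) :
    σ u = u ∧ σ D = -D := by
  have hm : 1 - u ≠ 0 := fun h0 => hu1 (by linear_combination (-1 - u) * h0)
  have hp : 1 + u ≠ 0 := fun h0 => hu1 (by linear_combination (u - 1) * h0)
  obtain ⟨x, hx⟩ : ∃ x, x = (1 + u) / (1 - u) := ⟨_, rfl⟩
  have hxm : x * (1 - u) = 1 + u := by rw [hx, div_mul_cancel₀ _ hm]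
  have hx0 : x ≠ 0 := by rw [hx]; exact div_ne_zero hp hm
  have hx1 : x ≠ 1 := by
    rintro rfl
    exact hu (by linear_combination (-1 / 2 : K) * hxm)
  have hxn : x ≠ -1 := by
    rintro rfl
    exact two_ne_zero (α := K) (by linear_combination -hxm)
  have hux : u = (x - 1) / (x + 1) := by
    rw [eq_div_iff fun h0 => hxn (eq_neg_of_add_eq_zero_left h0)]
    linear_combination -hxm
  have hcurve : (D * (x * (x - 1))) ^ 2 = -x * (x ^ 2 + 1) * (x ^ 2 - 2 * x - 1) := by
    rw [hx]
    field_simp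
    linear_combination -4 * h
  have hσx : σ x = x := fixed_of_curve hdeg hσ hcurve hx1 hxn
    (mul_ne_zero hD (mul_ne_zero hx0 (sub_ne_zero.2 hx1)))
  have hσu : σ u = u := by rw [hux]; simp [hσx]
  refine ⟨hσu, ?_⟩
  have hσD : σ D ^ 2 = D ^ 2 := by
    have h' := congrArg σ h
    simp only [map_mul, map_pow, map_sub, map_add, map_one, map_ofNat, hσu] at h'
    apply mul_right_cancel₀ (mul_ne_zero (pow_ne_zero 2 hu) (sub_ne_zero.2 hu1))
    linear_combination h' - h
  refine (sq_eq_sq_iff_eq_or_eq_neg.1 hσD).resolve_left fun hfix => ?_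
  obtain ⟨q, hq⟩ := exists_rat_of_fixed hdeg hσ hσx
  obtain ⟨e, he⟩ := exists_rat_of_fixed hdeg hσ hfix
  rw [← hq, ← he] at hcurve
  rcases curve_rational_points q (e * (q * (q - 1))) (by exact_mod_cast hcurve)
    with rfl | rfl | rfl
  · exact hx0 (by simpa using hq.symm)
  · exact hx1 (by simpa using hq.symm)
  · exact hxn (by simpa using hq.symm)

end Quadratic

theorem period_four_rational_c {K : Type*} [Field K] [NumberField K]
    (hdeg : Module.finrank ℚ K = 2) (c α : K) (h : HasExactPeriod c 4 α) :
    (∃ q : ℚ, (q : K) = c) ∧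
      ∀ σ : K ≃ₐ[ℚ] K, σ ≠ AlgEquiv.refl → σ α = (fc c)^[2] α := by
  obtain ⟨u, D, hD, hu, hu1, hcurve, hc, hα, hα2⟩ := exists_param_of_exact_period_four h
  constructor
  · obtain ⟨σ, hσ⟩ := exists_aut_ne_refl hdeg
    obtain ⟨hσu, hσD⟩ := conj_param hdeg hσ hD hu hu1 hcurve
    exact exists_rat_of_fixed hdeg hσ (by rw [hc]; simp [hσu, hσD, map_ofNat])
  · intro σ hσ
    obtain ⟨hσu, hσD⟩ := conj_param hdeg hσ hD hu hu1 hcurve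
    rw [hα2, hα]
    simp [hσu, hσD, map_ofNat, sub_eq_add_neg]
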